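/- arXiv:2603.12171 — 8 statements merged into one kernel-verified Lean document; each statement's English description precedes it below -/
import Mathlib

section
/- For every modal formula φ and propositional variable p, the following are equivalent: (1) φ is monotone in p; (2) the implication φ → φ[p/(p∨q)] is valid, where q is a propositional variable not occurring in φ. This equivalence holds both when 'monotone' and 'valid' are interpreted over all Kripke models and when both are interpreted over finite Kripke models. -/
/-- Multi-modal formulas with modality labels from `A` and
propositional variables indexed by `ℕ`. -/
inductive MF (A : Type) : Type
  | bot : MF A
  | var : ℕ → MF A
  | neg : MF A → MF A
  | and : MF A → MF A → MF A
  | or : MF A → MF A → MF A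
  | imp : MF A → MF A → MF A
  | dia : A → MF A → MF A
  | box : A → MF A → MF A

/-- Kripke models. -/
structure KModel (A : Type) where
  W : Type
  R : A → W → W → Prop
  V : ℕ → Set W

/-- `M[p ↦ X]`: change the valuation of variable `p` to `X`. -/
def KModel.update {A : Type} (M : KModel A) (p : ℕ) (X : Set M.W) : KModel A :=
  ⟨M.W, M.R, fun q => if q = p then X else M.V q⟩

/-- Kripke semantics. -/
def MSat {A : Type} (M : KModel A) : M.W → MF A → Prop
  | _, .bot => False
  | w, .var p => w ∈ M.V p
  | w, .neg φ => ¬ MSat M w φ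
  | w, .and φ ψ => MSat M w φ ∧ MSat M w ψ
  | w, .or φ ψ => MSat M w φ ∨ MSat M w ψ
  | w, .imp φ ψ => MSat M w φ → MSat M w ψ
  | w, .dia a φ => ∃ v, M.R a w v ∧ MSat M v φ
  | w, .box a φ => ∀ v, M.R a w v → MSat M v φ

/-- Uniform substitution `φ[p/θ]`. -/
def substMF {A : Type} (p : ℕ) (θ : MF A) : MF A → MF A
  | .bot => .bot
  | .var q => if q = p then θ else .var q
  | .neg φ => .neg (substMF p θ φ)
  | .and φ ψ => .and (substMF p θ φ) (substMF p θ ψ)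
  | .or φ ψ => .or (substMF p θ φ) (substMF p θ ψ)
  | .imp φ ψ => .imp (substMF p θ φ) (substMF p θ ψ)
  | .dia a φ => .dia a (substMF p θ φ)
  | .box a φ => .box a (substMF p θ φ)

/-- The set of propositional variables occurring in a formula. -/
def varsMF {A : Type} : MF A → Set ℕ
  | .bot => ∅
  | .var q => {q}
  | .neg φ => varsMF φ
  | .and φ ψ => varsMF φ ∪ varsMF ψ
  | .or φ ψ => varsMF φ ∪ varsMF ψ
  | .imp φ ψ => varsMF φ ∪ varsMF ψ
  | .dia _ φ => varsMF φ
  | .box _ φ => varsMF φ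

/-- Validity over all Kripke models. -/
def MValid {A : Type} (φ : MF A) : Prop :=
  ∀ (M : KModel A) (w : M.W), MSat M w φ

/-- Validity over all finite Kripke models. -/
def MValidFin {A : Type} (φ : MF A) : Prop :=
  ∀ (M : KModel A), Finite M.W → ∀ w : M.W, MSat M w φ

/-- `φ` is monotone in `p` (over all Kripke models). -/
def MonotoneIn {A : Type} (φ : MF A) (p : ℕ) : Prop :=
  ∀ (M : KModel A) (w : M.W), MSat M w φ →
    ∀ X : Set M.W, M.V p ⊆ X → MSat (M.update p X) w φ

/-- `φ` is monotone in `p` over finite Kripke models. -/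
def MonotoneInFin {A : Type} (φ : MF A) (p : ℕ) : Prop :=
  ∀ (M : KModel A), Finite M.W → ∀ w : M.W, MSat M w φ →
    ∀ X : Set M.W, M.V p ⊆ X → MSat (M.update p X) w φ

theorem msat_congr_of_eqOn_varsMF {A W : Type} (R : A → W → W → Prop) {V V' : ℕ → Set W}
    (φ : MF A) (h : Set.EqOn V V' (varsMF φ)) (w : W) :
    MSat ⟨W, R, V⟩ w φ ↔ MSat ⟨W, R, V'⟩ w φ := by
  induction φ generalizing w with
  | bot => simp only [MSat]
  | var r => simp only [MSat, h (show r ∈ varsMF (.var r : MF A) from rfl)]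
  | neg φ ih => simp only [MSat, ih h]
  | and φ ψ ih₁ ih₂ | or φ ψ ih₁ ih₂ | imp φ ψ ih₁ ih₂ =>
    simp only [MSat, ih₁ (h.mono Set.subset_union_left), ih₂ (h.mono Set.subset_union_right)]
  | dia a φ ih | box a φ ih => simp only [MSat, ih h]

theorem msat_substMF {A : Type} (M : KModel A) (p : ℕ) (θ φ : MF A) (w : M.W) :
    MSat M w (substMF p θ φ) ↔ MSat (M.update p {v | MSat M v θ}) w φ := by
  induction φ generalizing w with
  | bot => simp only [substMF, MSat]
  | var r =>
    by_cases hr : r = p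
    · simp only [substMF, MSat, KModel.update, if_pos hr]; rfl
    · simp only [substMF, MSat, KModel.update, if_neg hr]; rfl
  | neg φ ih => simp only [substMF, MSat, ih]
  | and φ ψ ih₁ ih₂ | or φ ψ ih₁ ih₂ | imp φ ψ ih₁ ih₂ =>
    simp only [substMF, MSat, ih₁, ih₂]
  | dia a φ ih | box a φ ih => simp only [substMF, MSat, ih]; rfl

/-- The equivalence relative to any class of models determined by the set of worlds. -/
theorem monotone_iff_valid_subst_of_carrier {A : Type} (P : Type → Prop) (φ : MF A) (p q : ℕ)
    (hq : q ∉ varsMF φ) :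
    (∀ M : KModel A, P M.W → ∀ w : M.W, MSat M w φ →
      ∀ X : Set M.W, M.V p ⊆ X → MSat (M.update p X) w φ) ↔
    ∀ M : KModel A, P M.W → ∀ w : M.W,
      MSat M w (.imp φ (substMF p (.or (.var p) (.var q)) φ)) := by
  constructor
  · intro h M hM w hw
    exact (msat_substMF M p _ φ w).2 (h M hM w hw _ fun v hv => Or.inl hv)
  · intro h M hM w hw X hX
    have hfresh : ∀ r ∈ varsMF φ, r ≠ q := fun r hr hrq => hq (hrq ▸ hr)
    have hw' : MSat (M.update q X) w φ :=
      (msat_congr_of_eqOn_varsMF M.R φ (fun r hr => (if_neg (hfresh r hr)).symm) w).1 hw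
    have hsub := (msat_substMF (M.update q X) p _ φ w).1 (h (M.update q X) hM w hw')
    refine (msat_congr_of_eqOn_varsMF M.R φ (fun r hr => ?_) w).1 hsub
    by_cases hr' : r = p
    · subst hr'
      ext v
      simp only [MSat, KModel.update, if_true, if_neg (hfresh r hr)]
      exact ⟨fun hv => hv.elim (fun hv => hX hv) id, Or.inr⟩
    · simp [KModel.update, hr', hfresh r hr]

/-- Proposition 2.2: monotonicity in `p` is equivalent to validity of
`φ → φ[p/(p ∨ q)]` for a fresh variable `q`, both over arbitrary Kripke models
and over finite Kripke models. -/
theorem monotone_iff_valid_subst {A : Type} (φ : MF A) (p q : ℕ)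
    (hq : q ∉ varsMF φ) :
    (MonotoneIn φ p ↔ MValid (.imp φ (substMF p (.or (.var p) (.var q)) φ))) ∧
    (MonotoneInFin φ p ↔ MValidFin (.imp φ (substMF p (.or (.var p) (.var q)) φ))) := by
  have hall := monotone_iff_valid_subst_of_carrier (fun _ => True) φ p q hq
  simp only [true_imp_iff] at hall
  exact ⟨hall, monotone_iff_valid_subst_of_carrier (fun W => Finite W) φ p q hq⟩
end

section
/- A modal formula φ is monotone in a propositional variable p over finite Kripke models if and only if φ is equivalent over finite Kripke models to a modal formula ψ that is positive in p (i.e., ψ is in negation normal form and contains no negated occurrence of p). -/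
/-- `ψ` is positive in `p`: it is in negation normal form (negations occur only
in front of propositional variables, and no `→` occurs) and `p` never occurs negated. -/
def PosIn {A : Type} (p : ℕ) : MF A → Prop
  | .bot => True
  | .var _ => True
  | .neg (.var q) => q ≠ p
  | .neg _ => False
  | .and φ ψ => PosIn p φ ∧ PosIn p ψ
  | .or φ ψ => PosIn p φ ∧ PosIn p ψ
  | .imp _ _ => False
  | .dia _ φ => PosIn p φ
  | .box _ φ => PosIn p φ

/-- The propositional variables of a formula, as a list. -/
def MF.variables {A : Type} : MF A → List ℕ
  | .bot => []
  | .var q => [q]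
  | .neg φ => φ.variables
  | .and φ ψ => φ.variables ++ ψ.variables
  | .or φ ψ => φ.variables ++ ψ.variables
  | .imp φ ψ => φ.variables ++ ψ.variables
  | .dia _ φ => φ.variables
  | .box _ φ => φ.variables

/-- The modality labels of a formula, as a list. -/
def MF.labels {A : Type} : MF A → List A
  | .bot => []
  | .var _ => []
  | .neg φ => φ.labels
  | .and φ ψ => φ.labels ++ ψ.labels
  | .or φ ψ => φ.labels ++ ψ.labels
  | .imp φ ψ => φ.labels ++ ψ.labels
  | .dia a φ => a :: φ.labels
  | .box a φ => a :: φ.labels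

/-- The modal depth of a formula. -/
def MF.depth {A : Type} : MF A → ℕ
  | .bot => 0
  | .var _ => 0
  | .neg φ => φ.depth
  | .and φ ψ => max φ.depth ψ.depth
  | .or φ ψ => max φ.depth ψ.depth
  | .imp φ ψ => max φ.depth ψ.depth
  | .dia _ φ => φ.depth + 1
  | .box _ φ => φ.depth + 1

/-- Finite conjunction. The empty conjunction is a tautology in a variable other than `p`,
so that it is positive in `p`. -/
def MF.conj {A : Type} (p : ℕ) (l : List (MF A)) : MF A :=
  l.foldr .and (.or (.var (p + 1)) (.neg (.var (p + 1))))

/-- Finite disjunction. -/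
def MF.disj {A : Type} (l : List (MF A)) : MF A :=
  l.foldr .or .bot

theorem msat_conj {A : Type} (p : ℕ) (M : KModel A) (w : M.W) (l : List (MF A)) :
    MSat M w (MF.conj p l) ↔ ∀ f ∈ l, MSat M w f := by
  induction l with
  | nil => simp [MF.conj, MSat, Classical.em]
  | cons f l ih => simpa [MF.conj, MSat] using fun _ => ih

theorem msat_disj {A : Type} (M : KModel A) (w : M.W) (l : List (MF A)) :
    MSat M w (MF.disj l) ↔ ∃ f ∈ l, MSat M w f := by
  induction l with
  | nil => simp [MF.disj, MSat]
  | cons f l ih => simpa [MF.disj, MSat] using or_congr Iff.rfl ih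

theorem posIn_conj {A : Type} {p : ℕ} {l : List (MF A)} (h : ∀ f ∈ l, PosIn p f) :
    PosIn p (MF.conj p l) := by
  induction l with
  | nil => simp [MF.conj, PosIn]
  | cons f l ih => exact ⟨h f (by simp), ih fun g hg => h g (by simp [hg])⟩

theorem posIn_disj {A : Type} {p : ℕ} {l : List (MF A)} (h : ∀ f ∈ l, PosIn p f) :
    PosIn p (MF.disj l) := by
  induction l with
  | nil => simp [MF.disj, PosIn]
  | cons f l ih => exact ⟨h f (by simp), ih fun g hg => h g (by simp [hg])⟩

/-- A finite list of formulas positive in `p` that contains, up to equivalence, enough formulas of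
depth at most `n` over the variables `P` and labels `L` to determine directed simulations. -/
def positiveBasis {A : Type} (p : ℕ) (P : List ℕ) (L : List A) : ℕ → List (MF A)
  | 0 => P.map .var ++ (P.filter (· ≠ p)).map fun q => .neg (.var q)
  | n + 1 => P.map .var ++ ((P.filter (· ≠ p)).map fun q => .neg (.var q)) ++
      L.flatMap fun a => (positiveBasis p P L n).sublists.flatMap fun S =>
        [.dia a (.conj p S), .box a (.disj S)]

section Basis

variable {A : Type} {p : ℕ} {P : List ℕ} {L : List A}

theorem posIn_of_mem_positiveBasis (n : ℕ) : ∀ f ∈ positiveBasis p P L n, PosIn p f := by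
  induction n with
  | zero =>
    intro f hf
    simp only [positiveBasis, List.mem_append, List.mem_map, List.mem_filter] at hf
    rcases hf with ⟨q, -, rfl⟩ | ⟨q, ⟨-, hq⟩, rfl⟩
    · trivial
    · simpa [PosIn] using hq
  | succ n ih =>
    intro f hf
    simp only [positiveBasis, List.mem_append, List.mem_map, List.mem_filter, List.mem_flatMap,
      List.mem_sublists, List.mem_cons, List.not_mem_nil, or_false] at hf
    rcases hf with (⟨q, -, rfl⟩ | ⟨q, ⟨-, hq⟩, rfl⟩) | ⟨a, -, S, hS, rfl | rfl⟩
    · trivial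
    · simpa [PosIn] using hq
    · exact posIn_conj fun g hg => ih g (hS.subset hg)
    · exact posIn_disj fun g hg => ih g (hS.subset hg)

theorem var_mem_positiveBasis {q : ℕ} (hq : q ∈ P) (n : ℕ) :
    .var q ∈ positiveBasis p P L n := by
  cases n <;> simp [positiveBasis, hq]

theorem neg_var_mem_positiveBasis {q : ℕ} (hq : q ∈ P) (hqp : q ≠ p) (n : ℕ) :
    .neg (.var q) ∈ positiveBasis p P L n := by
  cases n <;> simp [positiveBasis, hq, hqp]

theorem dia_mem_positiveBasis {a : A} (ha : a ∈ L) {n : ℕ} {S : List (MF A)}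
    (hS : S.Sublist (positiveBasis p P L n)) :
    .dia a (.conj p S) ∈ positiveBasis p P L (n + 1) := by
  simp only [positiveBasis, List.mem_append, List.mem_flatMap, List.mem_sublists]
  exact Or.inr ⟨a, ha, S, hS, by simp⟩

theorem box_mem_positiveBasis {a : A} (ha : a ∈ L) {n : ℕ} {S : List (MF A)}
    (hS : S.Sublist (positiveBasis p P L n)) :
    .box a (.disj S) ∈ positiveBasis p P L (n + 1) := by
  simp only [positiveBasis, List.mem_append, List.mem_flatMap, List.mem_sublists]
  exact Or.inr ⟨a, ha, S, hS, by simp⟩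

variable (p P L) in
/-- Every formula of the positive basis of depth `n` true at `x` is true at `y`. -/
def PosSim (M N : KModel A) (n : ℕ) (x : M.W) (y : N.W) : Prop :=
  ∀ f ∈ positiveBasis p P L n, MSat M x f → MSat N y f

variable {M N : KModel A} {n : ℕ} {x : M.W} {y : N.W}

theorem PosSim.var_imp (h : PosSim p P L M N n x y) {q : ℕ} (hq : q ∈ P) :
    x ∈ M.V q → y ∈ N.V q :=
  h _ (var_mem_positiveBasis hq n)

theorem PosSim.var_iff (h : PosSim p P L M N n x y) {q : ℕ} (hq : q ∈ P) (hqp : q ≠ p) :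
    x ∈ M.V q ↔ y ∈ N.V q :=
  ⟨h.var_imp hq, not_imp_not.1 (h _ (neg_var_mem_positiveBasis hq hqp n))⟩

theorem PosSim.forth (h : PosSim p P L M N (n + 1) x y) {a : A} (ha : a ∈ L) {x' : M.W}
    (hx : M.R a x x') : ∃ y', N.R a y y' ∧ PosSim p P L M N n x' y' := by
  classical
  have key := h _ (dia_mem_positiveBasis ha
    (List.filter_sublist (p := fun f => decide (MSat M x' f)) (l := positiveBasis p P L n)))
  obtain ⟨y', hy, hy'⟩ :=
    key ⟨x', hx, (msat_conj ..).2 fun f hf => by simpa using List.of_mem_filter hf⟩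
  exact ⟨y', hy, fun f hf hxf => (msat_conj ..).1 hy' f (by simp [hf, hxf])⟩

theorem PosSim.back (h : PosSim p P L M N (n + 1) x y) {a : A} (ha : a ∈ L) {y' : N.W}
    (hy : N.R a y y') : ∃ x', M.R a x x' ∧ PosSim p P L M N n x' y' := by
  classical
  have key := h _ (box_mem_positiveBasis ha
    (List.filter_sublist (p := fun f => decide (¬ MSat N y' f)) (l := positiveBasis p P L n)))
  by_contra! hno
  obtain ⟨f, hf, hyf⟩ := (msat_disj ..).1 (key (fun x' hx => by
    obtain ⟨f, hf, hxf, hyf⟩ : ∃ f ∈ positiveBasis p P L n, MSat M x' f ∧ ¬ MSat N y' f := by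
      simpa [PosSim] using hno x' hx
    exact (msat_disj ..).2 ⟨f, by simp [hf, hyf], hxf⟩) y' hy)
  exact absurd hyf (by simpa using List.of_mem_filter hf)

/-- Graded bisimulations preserve formulas of bounded depth. -/
theorem msat_iff_of_graded_bisim {K M : KModel A} (Z : ℕ → K.W → M.W → Prop)
    (hatom : ∀ k s x, Z k s x → ∀ q ∈ P, (s ∈ K.V q ↔ x ∈ M.V q))
    (hforth : ∀ k s x, Z (k + 1) s x → ∀ a ∈ L, ∀ s', K.R a s s' → ∃ x', M.R a x x' ∧ Z k s' x')
    (hback : ∀ k s x, Z (k + 1) s x → ∀ a ∈ L, ∀ x', M.R a x x' → ∃ s', K.R a s s' ∧ Z k s' x')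
    (ψ : MF A) (hP : ψ.variables ⊆ P) (hL : ψ.labels ⊆ L) :
    ∀ k s x, ψ.depth ≤ k → Z k s x → (MSat K s ψ ↔ MSat M x ψ) := by
  induction ψ with
  | bot => intros; rfl
  | var q => exact fun k s x _ hz => hatom k s x hz q (hP (by simp [MF.variables]))
  | neg φ ih => exact fun k s x hd hz => not_congr (ih hP hL k s x hd hz)
  | and φ ψ ih₁ ih₂ | or φ ψ ih₁ ih₂ | imp φ ψ ih₁ ih₂ =>
    intro k s x hd hz
    simp only [MF.variables, MF.labels, MF.depth, List.append_subset, max_le_iff] at hP hL hd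
    simp only [MSat, ih₁ hP.1 hL.1 k s x hd.1 hz, ih₂ hP.2 hL.2 k s x hd.2 hz]
  | dia a φ ih =>
    intro k s x hd hz
    simp only [MF.labels, List.cons_subset] at hL
    obtain ⟨k, rfl⟩ := Nat.exists_eq_add_of_le' (le_trans (Nat.le_add_left 1 φ.depth) hd)
    have ih := fun s x => ih hP hL.2 k s x (Nat.le_of_succ_le_succ hd)
    constructor
    · rintro ⟨s', hs, h⟩
      obtain ⟨x', hx, hz'⟩ := hforth k s x hz a hL.1 s' hs
      exact ⟨x', hx, (ih s' x' hz').1 h⟩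
    · rintro ⟨x', hx, h⟩
      obtain ⟨s', hs, hz'⟩ := hback k s x hz a hL.1 x' hx
      exact ⟨s', hs, (ih s' x' hz').2 h⟩
  | box a φ ih =>
    intro k s x hd hz
    simp only [MF.labels, List.cons_subset] at hL
    obtain ⟨k, rfl⟩ := Nat.exists_eq_add_of_le' (le_trans (Nat.le_add_left 1 φ.depth) hd)
    have ih := fun s x => ih hP hL.2 k s x (Nat.le_of_succ_le_succ hd)
    constructor
    · intro h x' hx
      obtain ⟨s', hs, hz'⟩ := hback k s x hz a hL.1 x' hx
      exact (ih s' x' hz').1 (h s' hs)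
    · intro h s' hs
      obtain ⟨x', hx, hz'⟩ := hforth k s x hz a hL.1 s' hs
      exact (ih s' x' hz').2 (h x' hx)

variable (p P L M N n) in
/-- The product of two models along `PosSim`, graded by the remaining depth,
with the valuation of the first component. -/
def simProduct : KModel A where
  W := {s : Fin (n + 1) × M.W × N.W // PosSim p P L M N s.1 s.2.1 s.2.2}
  R a s t := (s.1.1 : ℕ) = t.1.1 + 1 ∧ M.R a s.1.2.1 t.1.2.1 ∧ N.R a s.1.2.2 t.1.2.2
  V q := {s | s.1.2.1 ∈ M.V q}

theorem MonotoneInFin.msat_of_posSim {φ : MF A} (hφ : MonotoneInFin φ p) (hM : Finite M.W)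
    (hN : Finite N.W) (hp : p ∈ P) (hP : φ.variables ⊆ P) (hL : φ.labels ⊆ L)
    (h : PosSim p P L M N φ.depth x y) (hx : MSat M x φ) : MSat N y φ := by
  let K := simProduct p P L M N φ.depth
  have hK : Finite K.W := inferInstanceAs (Finite (Subtype _))
  let s : K.W := ⟨(Fin.last _, x, y), h⟩
  have hfst : MSat K s φ ↔ MSat M x φ := by
    refine msat_iff_of_graded_bisim (P := P) (L := L)
      (fun k (t : K.W) x => (t.1.1 : ℕ) = k ∧ t.1.2.1 = x) ?_ ?_ ?_ φ hP hL φ.depth s x le_rfl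
      ⟨rfl, rfl⟩
    · rintro k t _ ⟨-, rfl⟩ q _
      rfl
    · rintro k t _ ⟨hk, rfl⟩ a _ t' ⟨hk', hR, -⟩
      exact ⟨_, hR, by omega, rfl⟩
    · rintro k ⟨⟨i, x, y⟩, ht⟩ _ ⟨hk, rfl⟩ a ha x' hR
      obtain ⟨y', hR', ht'⟩ := PosSim.forth (n := k) (hk ▸ ht) ha hR
      exact ⟨⟨(⟨k, by have := i.2; simp only at hk; omega⟩, x', y'), ht'⟩, ⟨hk, hR, hR'⟩, rfl, rfl⟩
  let X : Set K.W := {t | t.1.2.2 ∈ N.V p}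
  have hsnd : MSat (K.update p X) s φ ↔ MSat N y φ := by
    refine msat_iff_of_graded_bisim (K := K.update p X) (P := P) (L := L)
      (fun k (t : K.W) y => (t.1.1 : ℕ) = k ∧ t.1.2.2 = y) ?_ ?_ ?_ φ hP hL φ.depth s y le_rfl
      ⟨rfl, rfl⟩
    · rintro k t _ ⟨-, rfl⟩ q hq
      by_cases hqp : q = p
      · subst hqp
        simp only [KModel.update, if_true]
        rfl
      · simp only [KModel.update, if_neg hqp]
        exact PosSim.var_iff t.2 hq hqp
    · rintro k t _ ⟨hk, rfl⟩ a _ t' ⟨hk', -, hR⟩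
      exact ⟨_, hR, by omega, rfl⟩
    · rintro k ⟨⟨i, x, y⟩, ht⟩ _ ⟨hk, rfl⟩ a ha y' hR
      obtain ⟨x', hR', ht'⟩ := PosSim.back (n := k) (hk ▸ ht) ha hR
      exact ⟨⟨(⟨k, by have := i.2; simp only at hk; omega⟩, x', y'), ht'⟩, ⟨hk, hR', hR⟩, rfl, rfl⟩
  exact hsnd.1 (hφ K hK s (hfst.2 hx) X fun t ht => PosSim.var_imp t.2 hp ht)

end Basis

theorem PosIn.msat_update {A : Type} {p : ℕ} {ψ : MF A} (hψ : PosIn p ψ) (M : KModel A)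
    {X : Set M.W} (hX : M.V p ⊆ X) : ∀ w, MSat M w ψ → MSat (M.update p X) w ψ := by
  induction ψ with
  | bot => exact fun _ h => h
  | var q =>
    intro w h
    by_cases hq : q = p
    · subst hq
      simp only [MSat, KModel.update, if_true]
      exact hX h
    · simp only [MSat, KModel.update, if_neg hq]
      exact h
  | neg φ _ =>
    cases φ with
    | var q =>
      have hq : q ≠ p := hψ
      intro w h
      simp only [MSat, KModel.update, if_neg hq]
      exact h
    | _ => exact hψ.elim
  | and φ ψ ih₁ ih₂ => exact fun w h => ⟨ih₁ hψ.1 w h.1, ih₂ hψ.2 w h.2⟩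
  | or φ ψ ih₁ ih₂ => exact fun w h => h.imp (ih₁ hψ.1 w) (ih₂ hψ.2 w)
  | imp => exact hψ.elim
  | dia a φ ih => exact fun w ⟨v, hR, h⟩ => ⟨v, hR, ih hψ v h⟩
  | box a φ ih => exact fun w h v hR => ih hψ v (h v hR)

/-- A modal formula is monotone in `p` over finite Kripke models iff it is
equivalent over finite Kripke models to a modal formula that is positive in `p`. -/
theorem monotoneFin_iff_positive {A : Type} (φ : MF A) (p : ℕ) :
    MonotoneInFin φ p ↔
      ∃ ψ : MF A, PosIn p ψ ∧
        ∀ (M : KModel A), Finite M.W → ∀ w : M.W, (MSat M w φ ↔ MSat M w ψ) := by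
  classical
  constructor
  · intro hφ
    let B := positiveBasis p (p :: φ.variables) φ.labels φ.depth
    let theoryOf (M : KModel A) (w : M.W) : List (MF A) := B.filter fun f => decide (MSat M w f)
    let T := B.sublists.filter fun S => decide (∃ (M : KModel A) (w : M.W),
      Finite M.W ∧ MSat M w φ ∧ theoryOf M w = S)
    refine ⟨.disj (T.map (.conj p)), posIn_disj fun f hf => ?_, fun N hN v => ?_⟩
    · obtain ⟨S, hS, rfl⟩ := List.mem_map.1 hf
      have hSB : S.Sublist B := List.mem_sublists.1 (List.mem_filter.1 hS).1
      exact posIn_conj fun g hg => posIn_of_mem_positiveBasis _ g (hSB.subset hg)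
    · rw [msat_disj]
      constructor
      · intro hv
        refine ⟨_, List.mem_map.2 ⟨theoryOf N v, List.mem_filter.2
          ⟨List.mem_sublists.2 List.filter_sublist, decide_eq_true ⟨N, v, hN, hv, rfl⟩⟩, rfl⟩, ?_⟩
        exact (msat_conj ..).2 fun f hf => by simpa using List.of_mem_filter hf
      · rintro ⟨_, hf, hv⟩
        obtain ⟨S, hS, rfl⟩ := List.mem_map.1 hf
        obtain ⟨M, w, hM, hw, rfl⟩ := of_decide_eq_true (List.mem_filter.1 hS).2
        refine hφ.msat_of_posSim (x := w) hM hN List.mem_cons_self (List.subset_cons_self _ _)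
          (List.Subset.refl _) (fun f hf hwf => ?_) hw
        exact (msat_conj ..).1 hv f (List.mem_filter.2 ⟨hf, decide_eq_true hwf⟩)
  · rintro ⟨ψ, hψ, heq⟩ M hM w hw X hX
    exact (heq (M.update p X) hM w).2 (hψ.msat_update M hX w ((heq M hM w).1 hw))
end

section
/- For every modal formula φ, the following are equivalent: (1) φ is preserved under induced substructures; (2) the implication (p ∧ φ) → φ^p is valid, where p is a propositional variable not occurring in φ and φ^p is the relativization of φ to p. This equivalence holds both when 'preserved' and 'valid' are interpreted over all Kripke models and when both are interpreted over finite Kripke models. -/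
/-- The restriction `M|X` of a Kripke model to a subset `X` of its domain. -/
def KModel.restrict {A : Type} (M : KModel A) (X : Set M.W) : KModel A :=
  ⟨X, fun a u v => M.R a u.1 v.1, fun q => {u | (u : M.W) ∈ M.V q}⟩

/-- The relativization `φ^p` of `φ` to the variable `p`. -/
def relativize {A : Type} (p : ℕ) : MF A → MF A
  | .bot => .bot
  | .var q => .var q
  | .neg φ => .neg (relativize p φ)
  | .and φ ψ => .and (relativize p φ) (relativize p ψ)
  | .or φ ψ => .or (relativize p φ) (relativize p ψ)
  | .imp φ ψ => .imp (relativize p φ) (relativize p ψ)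
  | .dia a φ => .dia a (.and (.var p) (relativize p φ))
  | .box a φ => .box a (.imp (.var p) (relativize p φ))

/-- `φ` is preserved under induced substructures (over all Kripke models). -/
def PresSub {A : Type} (φ : MF A) : Prop :=
  ∀ (M : KModel A) (X : Set M.W) (w : M.W) (hw : w ∈ X),
    MSat M w φ → MSat (M.restrict X) ⟨w, hw⟩ φ

/-- `φ` is preserved under induced substructures, over finite Kripke models. -/
def PresSubFin {A : Type} (φ : MF A) : Prop :=
  ∀ (M : KModel A), Finite M.W → ∀ (X : Set M.W) (w : M.W) (hw : w ∈ X),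
    MSat M w φ → MSat (M.restrict X) ⟨w, hw⟩ φ

/-- Satisfaction depends only on the valuation of the variables occurring in the formula. -/
theorem MSat_congr_valuation {A W : Type} {R : A → W → W → Prop} {V V' : ℕ → Set W}
    {φ : MF A} (h : ∀ q ∈ varsMF φ, V q = V' q) (w : W) :
    MSat ⟨W, R, V⟩ w φ ↔ MSat ⟨W, R, V'⟩ w φ := by
  induction φ generalizing w with
  | bot => exact Iff.rfl
  | var q => simp only [MSat, h q rfl]
  | neg φ ih => exact not_congr (ih h w)
  | and φ ψ ih₁ ih₂ =>
    exact and_congr (ih₁ (fun q hq => h q (.inl hq)) w) (ih₂ (fun q hq => h q (.inr hq)) w)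
  | or φ ψ ih₁ ih₂ =>
    exact or_congr (ih₁ (fun q hq => h q (.inl hq)) w) (ih₂ (fun q hq => h q (.inr hq)) w)
  | imp φ ψ ih₁ ih₂ =>
    exact imp_congr (ih₁ (fun q hq => h q (.inl hq)) w) (ih₂ (fun q hq => h q (.inr hq)) w)
  | dia a φ ih => exact exists_congr fun v => and_congr_right fun _ => ih h v
  | box a φ ih => exact forall_congr' fun v => imp_congr_right fun _ => ih h v

/-- The relativization `φ^p` holds in `M` exactly when `φ` holds in the restriction of `M`
to the set `X` of worlds satisfying `p`. -/
theorem MSat_relativize_iff {A : Type} (M : KModel A) {p : ℕ} {X : Set M.W} (hX : M.V p = X)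
    (φ : MF A) (w : M.W) (hw : w ∈ X) :
    MSat M w (relativize p φ) ↔ MSat (M.restrict X) ⟨w, hw⟩ φ := by
  subst hX
  induction φ generalizing w with
  | bot => exact Iff.rfl
  | var q => exact Iff.rfl
  | neg φ ih => exact not_congr (ih w hw)
  | and φ ψ ih₁ ih₂ => exact and_congr (ih₁ w hw) (ih₂ w hw)
  | or φ ψ ih₁ ih₂ => exact or_congr (ih₁ w hw) (ih₂ w hw)
  | imp φ ψ ih₁ ih₂ => exact imp_congr (ih₁ w hw) (ih₂ w hw)
  | dia a φ ih =>
    constructor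
    · rintro ⟨v, hR, hv, hφ⟩
      exact ⟨⟨v, hv⟩, hR, (ih v hv).1 hφ⟩
    · rintro ⟨⟨v, hv⟩, hR, hφ⟩
      exact ⟨v, hR, hv, (ih v hv).2 hφ⟩
  | box a φ ih =>
    constructor
    · rintro h ⟨v, hv⟩ hR
      exact (ih v hv).1 (h v hR hv)
    · intro h v hR hv
      exact (ih v hv).2 (h ⟨v, hv⟩ hR)

/-- Updating a variable that does not occur in `φ` does not affect satisfaction of `φ`. -/
theorem MSat_update_iff {A : Type} (M : KModel A) {p : ℕ} (X : Set M.W) {φ : MF A}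
    (hp : p ∉ varsMF φ) (w : M.W) : MSat (M.update p X) w φ ↔ MSat M w φ :=
  MSat_congr_valuation (fun _ hq => if_neg (ne_of_mem_of_not_mem hq hp)) w

/-- With `p` fresh and interpreted as `X`, the relativization `φ^p` expresses truth of `φ`
in the restriction to `X`. -/
theorem MSat_update_relativize_iff {A : Type} (M : KModel A) {p : ℕ} (X : Set M.W) {φ : MF A}
    (hp : p ∉ varsMF φ) (w : M.W) (hw : w ∈ X) :
    MSat (M.update p X) w (relativize p φ) ↔ MSat (M.restrict X) ⟨w, hw⟩ φ := by
  refine (MSat_relativize_iff (M.update p X) (if_pos rfl) φ w hw).trans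
    (MSat_congr_valuation (fun q hq => ?_) _)
  exact congrArg (fun S : Set M.W => {u : X | (u : M.W) ∈ S})
    (if_neg (ne_of_mem_of_not_mem hq hp))

/-- If `(p ∧ φ) → φ^p` is true at `w ∈ X` when the fresh variable `p` is interpreted as `X`,
then truth of `φ` at `w` is preserved under restriction to `X`. -/
theorem MSat_restrict_of_update {A : Type} (M : KModel A) {p : ℕ} {X : Set M.W} {φ : MF A}
    (hp : p ∉ varsMF φ) {w : M.W} (hw : w ∈ X)
    (h : MSat (M.update p X) w (.imp (.and (.var p) φ) (relativize p φ)))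
    (hφ : MSat M w φ) : MSat (M.restrict X) ⟨w, hw⟩ φ := by
  have hX : (M.update p X).V p = X := if_pos rfl
  exact (MSat_update_relativize_iff M X hp w hw).1
    (h ⟨hX.superset hw, (MSat_update_iff M X hp w).2 hφ⟩)

/-- Proposition 2.5: preservation under induced substructures is equivalent to
validity of `(p ∧ φ) → φ^p` for a fresh variable `p`, both over arbitrary
Kripke models and over finite Kripke models. -/
theorem presSub_iff_valid_relativization {A : Type} (φ : MF A) (p : ℕ)
    (hp : p ∉ varsMF φ) :
    (PresSub φ ↔ MValid (.imp (.and (.var p) φ) (relativize p φ))) ∧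
    (PresSubFin φ ↔ MValidFin (.imp (.and (.var p) φ) (relativize p φ))) := by
  refine ⟨⟨fun h M w hw => ?_, fun h M X w hw hφ => ?_⟩,
    ⟨fun h M hM w hw => ?_, fun h M hM X w hw hφ => ?_⟩⟩
  · exact (MSat_relativize_iff M rfl φ w hw.1).2 (h M (M.V p) w hw.1 hw.2)
  · exact MSat_restrict_of_update M hp hw (h (M.update p X) w) hφ
  · exact (MSat_relativize_iff M rfl φ w hw.1).2 (h M hM (M.V p) w hw.1 hw.2)
  · exact MSat_restrict_of_update M hp hw (h (M.update p X) hM w) hφ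
end

section
/- For every modal formula φ and propositional variable p, the following are equivalent, where q₁,q₂ are distinct propositional variables not occurring in φ: (1) φ is completely additive in p; (2) both φ[p/(q₁∨q₂)] ↔ (φ[p/q₁] ∨ φ[p/q₂]) and ¬φ[p/⊥] are valid. This equivalence holds both when 'completely additive' and 'valid' are interpreted over all Kripke models and when both are interpreted over finite Kripke models. -/
/-- `φ` is completely additive in `p` (over all Kripke models). -/
def CompAdd {A : Type} (φ : MF A) (p : ℕ) : Prop :=
  MonotoneIn φ p ∧
    ∀ (M : KModel A) (w : M.W), MSat M w φ →
      ∃ v ∈ M.V p, MSat (M.update p {v}) w φ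

/-- `φ` is completely additive in `p` over finite Kripke models. -/
def CompAddFin {A : Type} (φ : MF A) (p : ℕ) : Prop :=
  MonotoneInFin φ p ∧
    ∀ (M : KModel A), Finite M.W → ∀ w : M.W, MSat M w φ →
      ∃ v ∈ M.V p, MSat (M.update p {v}) w φ

/-! ### Valuations and substitution -/

theorem msat_congr {A W : Type} {R : A → W → W → Prop} {V V' : ℕ → Set W} (φ : MF A)
    (h : ∀ q ∈ varsMF φ, V q = V' q) (w : W) :
    MSat ⟨W, R, V⟩ w φ ↔ MSat ⟨W, R, V'⟩ w φ := by
  induction φ generalizing w with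
  | bot => rfl
  | var q => simp [MSat, h q rfl]
  | neg φ ih => simp only [MSat, ih h]
  | and φ ψ ih₁ ih₂ | or φ ψ ih₁ ih₂ | imp φ ψ ih₁ ih₂ =>
    simp only [MSat, ih₁ fun q hq => h q (Or.inl hq), ih₂ fun q hq => h q (Or.inr hq)]
  | dia a φ ih | box a φ ih => simp only [MSat, ih h]

theorem msat_update_self {A : Type} (M : KModel A) (p : ℕ) (φ : MF A) (w : M.W) :
    MSat (M.update p (M.V p)) w φ ↔ MSat M w φ := by
  refine msat_congr φ (fun q _ => ?_) w
  by_cases hq : q = p <;> simp [hq]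

theorem mem_update_self {A : Type} (M : KModel A) (p : ℕ) (X : Set M.W) (w : M.W) :
    w ∈ (M.update p X).V p ↔ w ∈ X :=
  Set.ext_iff.1 (if_pos rfl : (M.update p X).V p = X) w

theorem mem_update_of_ne {A : Type} (M : KModel A) {p q : ℕ} (hq : q ≠ p) (X : Set M.W)
    (w : M.W) : w ∈ (M.update p X).V q ↔ w ∈ M.V q :=
  Set.ext_iff.1 (if_neg hq : (M.update p X).V q = M.V q) w

/-- `φ`, as a predicate of the extension of `p`, preserves finite unions over the models whose
set of worlds satisfies `Q`. -/
structure FinAdd {A : Type} (Q : Type → Prop) (φ : MF A) (p : ℕ) : Prop where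
  union : ∀ M : KModel A, Q M.W → ∀ (w : M.W) (X Y : Set M.W),
    MSat (M.update p (X ∪ Y)) w φ ↔ MSat (M.update p X) w φ ∨ MSat (M.update p Y) w φ
  empty : ∀ M : KModel A, Q M.W → ∀ w : M.W, ¬ MSat (M.update p ∅) w φ

theorem FinAdd.mono {A : Type} {Q : Type → Prop} {φ : MF A} {p : ℕ} (h : FinAdd Q φ p)
    (M : KModel A) (hM : Q M.W) (w : M.W) {X Y : Set M.W} (hXY : X ⊆ Y)
    (hX : MSat (M.update p X) w φ) : MSat (M.update p Y) w φ := by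
  rw [← Set.union_eq_self_of_subset_left hXY]
  exact (h.union M hM w X Y).2 (Or.inl hX)

theorem finAdd_iff_valid {A : Type} (Q : Type → Prop) (φ : MF A) (p q₁ q₂ : ℕ) (hq : q₁ ≠ q₂)
    (h₁ : q₁ ∉ varsMF φ) (h₂ : q₂ ∉ varsMF φ) :
    FinAdd Q φ p ↔
      (∀ M : KModel A, Q M.W → ∀ w : M.W, MSat M w (.and
          (.imp (substMF p (.or (.var q₁) (.var q₂)) φ)
                (.or (substMF p (.var q₁) φ) (substMF p (.var q₂) φ)))
          (.imp (.or (substMF p (.var q₁) φ) (substMF p (.var q₂) φ))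
                (substMF p (.or (.var q₁) (.var q₂)) φ)))) ∧
        ∀ M : KModel A, Q M.W → ∀ w : M.W, MSat M w (.neg (substMF p .bot φ)) := by
  constructor
  · intro h
    refine ⟨fun M hM w => ?_, fun M hM w => ?_⟩
    · have := h.union M hM w (M.V q₁) (M.V q₂)
      simp only [MSat, msat_substMF]
      exact ⟨this.1, this.2⟩
    · simp only [MSat, msat_substMF]
      exact h.empty M hM w
  · rintro ⟨h, h0⟩
    refine ⟨fun M hM w X Y => ?_, fun M hM w => ?_⟩
    · let N := (M.update q₁ X).update q₂ Y
      have key : ∀ Z : Set M.W, MSat (N.update p Z) w φ ↔ MSat (M.update p Z) w φ := fun Z => by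
        refine msat_congr φ (fun q hqφ => ?_) w
        have e₁ : q ≠ q₁ := fun e => h₁ (e ▸ hqφ)
        have e₂ : q ≠ q₂ := fun e => h₂ (e ▸ hqφ)
        simp [N, KModel.update, e₁, e₂]
      have hX : N.V q₁ = X := by simp [N, KModel.update, hq]
      have hY : N.V q₂ = Y := by simp [N, KModel.update]
      rw [← key, ← key, ← key, ← hX, ← hY]
      have e := msat_substMF N p (.or (.var q₁) (.var q₂)) φ w
      have e₁ := msat_substMF N p (.var q₁) φ w
      have e₂ := msat_substMF N p (.var q₂) φ w
      exact e.symm.trans (Iff.trans ⟨(h N hM w).1, (h N hM w).2⟩ (or_congr e₁ e₂))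
    · have := h0 M hM w
      simp only [MSat, msat_substMF] at this
      exact this

/-- Complete additivity over the models whose set of worlds satisfies `Q` implies preservation of
finite unions. -/
theorem finAdd_of_compAdd {A : Type} (Q : Type → Prop) (φ : MF A) (p : ℕ)
    (hmono : ∀ M : KModel A, Q M.W → ∀ w : M.W, MSat M w φ →
      ∀ X : Set M.W, M.V p ⊆ X → MSat (M.update p X) w φ)
    (hadd : ∀ M : KModel A, Q M.W → ∀ w : M.W, MSat M w φ →
      ∃ v ∈ M.V p, MSat (M.update p {v}) w φ) : FinAdd Q φ p := by
  have upd : ∀ (M : KModel A) (X : Set M.W), (M.update p X).V p = X := fun M X => by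
    simp [KModel.update]
  have upd₂ : ∀ (M : KModel A) (X Y : Set M.W) (w : M.W),
      MSat ((M.update p X).update p Y) w φ ↔ MSat (M.update p Y) w φ := fun M X Y w => by
    refine msat_congr φ (fun q _ => ?_) w
    by_cases hq : q = p <;> simp [KModel.update, hq]
  have mono : ∀ M : KModel A, Q M.W → ∀ (w : M.W) (X Y : Set M.W), X ⊆ Y →
      MSat (M.update p X) w φ → MSat (M.update p Y) w φ := fun M hM w X Y hXY h =>
    (upd₂ M X Y w).1 (hmono (M.update p X) hM w h Y (by rw [upd]; exact hXY))
  have add : ∀ M : KModel A, Q M.W → ∀ (w : M.W) (X : Set M.W),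
      MSat (M.update p X) w φ → ∃ v ∈ X, MSat (M.update p {v}) w φ := fun M hM w X h => by
    obtain ⟨v, hv, hs⟩ := hadd (M.update p X) hM w h
    rw [upd] at hv
    exact ⟨v, hv, (upd₂ M X {v} w).1 hs⟩
  refine ⟨fun M hM w X Y => ⟨fun h => ?_, ?_⟩, fun M hM w h => ?_⟩
  · obtain ⟨v, hv | hv, hs⟩ := add M hM w _ h
    · exact Or.inl (mono M hM w {v} X (Set.singleton_subset_iff.2 hv) hs)
    · exact Or.inr (mono M hM w {v} Y (Set.singleton_subset_iff.2 hv) hs)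
  · rintro (h | h)
    · exact mono M hM w X _ Set.subset_union_left h
    · exact mono M hM w Y _ Set.subset_union_right h
  · obtain ⟨v, hv, -⟩ := add M hM w _ h
    exact hv

/-- A predicate of sets that distributes over finite unions and fails on `∅` holds on some fibre
of any map with finite image. -/
theorem exists_fibre_of_union {W β : Type} (F : Set W → Prop)
    (hF : ∀ X Y, F (X ∪ Y) → F X ∨ F Y) (h0 : ¬ F ∅) (f : W → β) (X : Set W)
    (hfin : (f '' X).Finite) (hX : F X) : ∃ b, F {x ∈ X | f x = b} := by
  have key : ∀ s : Set β, s.Finite → F {x ∈ X | f x ∈ s} → ∃ b, F {x ∈ X | f x = b} := by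
    intro s hs
    induction s, hs using Set.Finite.induction_on with
    | empty => simp [h0]
    | @insert a s _ _ ih =>
      intro h
      have e : {x ∈ X | f x ∈ insert a s} = {x ∈ X | f x = a} ∪ {x ∈ X | f x ∈ s} := by
        ext x; simp [and_or_left]
      rw [e] at h
      exact (hF _ _ h).elim (fun h => ⟨a, h⟩) ih
  refine key _ hfin ?_
  have e : {x ∈ X | f x ∈ f '' X} = X := by
    ext x; simpa using fun hx => ⟨x, hx, rfl⟩
  rwa [e]

/-! ### Depth-bounded types -/

/-- Modal depth. -/
def depthMF {A : Type} : MF A → ℕ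
  | .bot => 0
  | .var _ => 0
  | .neg φ => depthMF φ
  | .and φ ψ => max (depthMF φ) (depthMF ψ)
  | .or φ ψ => max (depthMF φ) (depthMF ψ)
  | .imp φ ψ => max (depthMF φ) (depthMF ψ)
  | .dia _ φ => depthMF φ + 1
  | .box _ φ => depthMF φ + 1

/-- The set of modality labels occurring in a formula. -/
def labelsMF {A : Type} : MF A → Set A
  | .bot => ∅
  | .var _ => ∅
  | .neg φ => labelsMF φ
  | .and φ ψ => labelsMF φ ∪ labelsMF ψ
  | .or φ ψ => labelsMF φ ∪ labelsMF ψ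
  | .imp φ ψ => labelsMF φ ∪ labelsMF ψ
  | .dia a φ => insert a (labelsMF φ)
  | .box a φ => insert a (labelsMF φ)

theorem finite_varsMF {A : Type} (φ : MF A) : (varsMF φ).Finite := by
  induction φ <;> simp_all [varsMF]

theorem finite_labelsMF {A : Type} (φ : MF A) : (labelsMF φ).Finite := by
  induction φ <;> simp_all [labelsMF]

/-- Bisimulation types of depth `k` over the labels `S` and the variables `P`. -/
def DepthType {A : Type} (S : Set A) (P : Set ℕ) : ℕ → Type
  | 0 => Set P
  | k + 1 => Set P × (S → Set (DepthType S P k))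

theorem DepthType.finite {A : Type} (S : Set A) (P : Set ℕ) [Finite S] [Finite P] :
    ∀ k, Finite (DepthType S P k)
  | 0 => inferInstanceAs (Finite (Set P))
  | k + 1 => by
    have := DepthType.finite S P k
    exact inferInstanceAs (Finite (Set P × (S → Set (DepthType S P k))))

/-- The depth-`k` type of a world. -/
def depthType {A : Type} (S : Set A) (P : Set ℕ) (M : KModel A) :
    (k : ℕ) → M.W → DepthType S P k
  | 0, x => {q : P | x ∈ M.V q}
  | k + 1, x => ({q : P | x ∈ M.V q}, fun a => depthType S P M k '' {y | M.R a x y})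

section DepthTypeLemmas

variable {A : Type} {S : Set A} {P : Set ℕ} {M M' : KModel A}

theorem mem_iff_of_depthType_eq {k : ℕ} {x : M.W} {y : M'.W}
    (h : depthType S P M k x = depthType S P M' k y) {q : ℕ} (hq : q ∈ P) :
    x ∈ M.V q ↔ y ∈ M'.V q := by
  cases k with
  | zero => exact Set.ext_iff.1 h ⟨q, hq⟩
  | succ k => exact Set.ext_iff.1 (congrArg Prod.fst h) ⟨q, hq⟩

theorem exists_of_depthType_eq {k : ℕ} {x : M.W} {y : M'.W}
    (h : depthType S P M (k + 1) x = depthType S P M' (k + 1) y) {a : A} (ha : a ∈ S)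
    {x' : M.W} (hx : M.R a x x') :
    ∃ y', M'.R a y y' ∧ depthType S P M k x' = depthType S P M' k y' := by
  have e := congrFun (congrArg Prod.snd h) ⟨a, ha⟩
  have hm : depthType S P M k x' ∈ depthType S P M k '' {y | M.R a x y} := ⟨x', hx, rfl⟩
  obtain ⟨y', hy, hxy⟩ := (Set.ext_iff.1 e _).1 hm
  exact ⟨y', hy, hxy.symm⟩

theorem depthType_eq_of_bisim (Z : ℕ → M.W → M'.W → Prop)
    (atom : ∀ k x y, Z k x y → ∀ q ∈ P, x ∈ M.V q ↔ y ∈ M'.V q)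
    (forth : ∀ k x y, Z (k + 1) x y → ∀ a ∈ S, ∀ x', M.R a x x' → ∃ y', M'.R a y y' ∧ Z k x' y')
    (back : ∀ k x y, Z (k + 1) x y → ∀ a ∈ S, ∀ y', M'.R a y y' → ∃ x', M.R a x x' ∧ Z k x' y') :
    ∀ k x y, Z k x y → depthType S P M k x = depthType S P M' k y
  | 0, x, y, h => Set.ext fun q => atom 0 x y h q q.2
  | k + 1, x, y, h => by
    have ih := depthType_eq_of_bisim Z atom forth back k
    refine Prod.ext (Set.ext fun q => atom _ x y h q q.2) (funext fun a => Set.ext fun t => ?_)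
    constructor
    · rintro ⟨x', hx, rfl⟩
      obtain ⟨y', hy, hz⟩ := forth k x y h a a.2 x' hx
      exact ⟨y', hy, (ih _ _ hz).symm⟩
    · rintro ⟨y', hy, rfl⟩
      obtain ⟨x', hx, hz⟩ := back k x y h a a.2 y' hy
      exact ⟨x', hx, ih _ _ hz⟩

theorem depthType_eq_of_succ {k : ℕ} : ∀ {x : M.W} {y : M'.W},
    depthType S P M (k + 1) x = depthType S P M' (k + 1) y →
      depthType S P M k x = depthType S P M' k y := by
  intro x y h
  refine depthType_eq_of_bisim
    (fun k x y => depthType S P M (k + 1) x = depthType S P M' (k + 1) y)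
    (fun _ _ _ h q hq => mem_iff_of_depthType_eq h hq)
    (fun _ _ _ h a ha x' hx => exists_of_depthType_eq h ha hx)
    (fun _ _ _ h a ha y' hy => ?_) k x y h
  obtain ⟨x', hx, e⟩ := exists_of_depthType_eq h.symm ha hy
  exact ⟨x', hx, e.symm⟩

theorem depthType_eq_of_le {k n : ℕ} (hkn : k ≤ n) {x : M.W} {y : M'.W}
    (h : depthType S P M n x = depthType S P M' n y) :
    depthType S P M k x = depthType S P M' k y := by
  induction hkn with
  | refl => exact h
  | step _ ih => exact ih (depthType_eq_of_succ h)

theorem msat_iff_of_depthType_eq (φ : MF A) (hS : labelsMF φ ⊆ S) (hP : varsMF φ ⊆ P) {k : ℕ}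
    (hk : depthMF φ ≤ k) {x : M.W} {y : M'.W}
    (h : depthType S P M k x = depthType S P M' k y) : MSat M x φ ↔ MSat M' y φ := by
  induction φ generalizing k x y with
  | bot => rfl
  | var q => exact mem_iff_of_depthType_eq h (hP rfl)
  | neg φ ih => exact not_congr (ih hS hP hk h)
  | and φ ψ ih₁ ih₂ | or φ ψ ih₁ ih₂ | imp φ ψ ih₁ ih₂ =>
    have e₁ := ih₁ (Set.subset_union_left.trans hS) (Set.subset_union_left.trans hP)
      ((le_max_left _ _).trans hk) h
    have e₂ := ih₂ (Set.subset_union_right.trans hS) (Set.subset_union_right.trans hP)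
      ((le_max_right _ _).trans hk) h
    simp only [MSat, e₁, e₂]
  | dia a φ ih =>
    have ha : a ∈ S := hS (Set.mem_insert _ _)
    have hS' := (Set.subset_insert _ _).trans hS
    have h' := depthType_eq_of_le hk h
    constructor
    · rintro ⟨x', hx, hs⟩
      obtain ⟨y', hy, e⟩ := exists_of_depthType_eq h' ha hx
      exact ⟨y', hy, (ih hS' hP le_rfl e).1 hs⟩
    · rintro ⟨y', hy, hs⟩
      obtain ⟨x', hx, e⟩ := exists_of_depthType_eq h'.symm ha hy
      exact ⟨x', hx, (ih hS' hP le_rfl e.symm).2 hs⟩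
  | box a φ ih =>
    have ha : a ∈ S := hS (Set.mem_insert _ _)
    have hS' := (Set.subset_insert _ _).trans hS
    have h' := depthType_eq_of_le hk h
    constructor
    · intro H y' hy
      obtain ⟨x', hx, e⟩ := exists_of_depthType_eq h'.symm ha hy
      exact (ih hS' hP le_rfl e.symm).1 (H x' hx)
    · intro H x' hx
      obtain ⟨y', hy, e⟩ := exists_of_depthType_eq h' ha hx
      exact (ih hS' hP le_rfl e).2 (H y' hy)

end DepthTypeLemmas

/-! ### The doubled unravelling -/

section Unravelling

variable {A : Type} (S : Set A) (M : KModel A) (w : M.W)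

/-- The last world of a path from `w`; the most recent step is the head of the list. -/
def pathEnd : List (S × M.W × Bool) → M.W
  | [] => w
  | e :: _ => e.2.1

/-- The unravelling of `M` at `w` along the labels in `S`, where every step comes in two copies.
The worlds include lists that are not paths; these are not reachable from the root `[]`. -/
def unravel : KModel A where
  W := List (S × M.W × Bool)
  R a l l' := ∃ (ha : a ∈ S) (v : M.W) (b : Bool),
    M.R a (pathEnd S M w l) v ∧ l' = (⟨a, ha⟩, v, b) :: l
  V q := {l | pathEnd S M w l ∈ M.V q}

/-- The lists that are paths of `M` starting at `w`. -/
def IsPath : List (S × M.W × Bool) → Prop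
  | [] => True
  | e :: l => M.R e.1 (pathEnd S M w l) e.2.1 ∧ IsPath l

variable {S M w}

theorem IsPath.of_suffix {l c : List (S × M.W × Bool)} (h : l <:+ c) (hc : IsPath S M w c) :
    IsPath S M w l := by
  induction c with
  | nil => rw [List.suffix_nil.1 h]; trivial
  | cons e c ih =>
    rcases List.suffix_cons_iff.1 h with rfl | h
    · exact hc
    · exact ih h hc.2

theorem depthType_unravel (P : Set ℕ) (p n : ℕ) (X : Set M.W) :
    depthType S P ((unravel S M w).update p
        {l | pathEnd S M w l ∈ X ∧ IsPath S M w l ∧ l.length ≤ n}) n ([] : List _) =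
      depthType S P (M.update p X) n w := by
  refine depthType_eq_of_bisim (M := (unravel S M w).update p
        {l | pathEnd S M w l ∈ X ∧ IsPath S M w l ∧ l.length ≤ n}) (M' := M.update p X)
    (fun k (l : List (S × M.W × Bool)) (x : M.W) =>
      pathEnd S M w l = x ∧ IsPath S M w l ∧ k + l.length = n) ?_ ?_ ?_ n _ _ ⟨rfl, trivial, rfl⟩
  · rintro k (l : List (S × M.W × Bool)) x ⟨rfl, hl, hk⟩ q -
    by_cases hq : q = p
    · subst hq
      refine (mem_update_self (unravel S M w) q _ l).trans
        (Iff.trans ?_ (mem_update_self M q X _).symm)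
      exact ⟨fun h => h.1, fun h => ⟨h, hl, by omega⟩⟩
    · exact (mem_update_of_ne (unravel S M w) hq _ l).trans (mem_update_of_ne M hq X _).symm
  · rintro k (l : List (S × M.W × Bool)) x ⟨rfl, hl, hk⟩ a - l' ⟨ha, v, b, hv, rfl⟩
    exact ⟨v, hv, rfl, ⟨hv, hl⟩, (Nat.succ_add_eq_add_succ k l.length).symm.trans hk⟩
  · rintro k (l : List (S × M.W × Bool)) x ⟨rfl, hl, hk⟩ a ha v hv
    exact ⟨(⟨a, ha⟩, v, true) :: l, ⟨ha, v, true, hv, rfl⟩, rfl, ⟨hv, hl⟩,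
      (Nat.succ_add_eq_add_succ k l.length).symm.trans hk⟩

/-- The trace of a path with respect to an assignment `t` of types to worlds: at each step, the
label, the copy, and the type of the world reached, of depth `n` minus the number of steps taken
so far. -/
def pathTrace {W : Type} {T : ℕ → Type} (t : (k : ℕ) → W → T k) (n : ℕ) :
    List (S × W × Bool) → List (S × Bool × (Σ k : Fin (n + 1), T k))
  | [] => []
  | e :: l => (e.1, e.2.2, ⟨⟨n - (l.length + 1), by omega⟩, t _ e.2.1⟩) :: pathTrace t n l

section Trace

variable {W : Type} {T : ℕ → Type} (t : (k : ℕ) → W → T k) (n : ℕ)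

@[simp]
theorem length_pathTrace (l : List (S × W × Bool)) : (pathTrace t n l).length = l.length := by
  induction l with
  | nil => rfl
  | cons e l ih => simp [pathTrace, ih]

theorem pathTrace_suffix {l c : List (S × W × Bool)} (h : l <:+ c) :
    pathTrace t n l <:+ pathTrace t n c := by
  induction c with
  | nil => rw [List.suffix_nil.1 h]
  | cons e c ih =>
    rcases List.suffix_cons_iff.1 h with rfl | h
    · exact List.suffix_rfl
    · exact (ih h).trans (List.suffix_cons _ _)

theorem pathTrace_cons_eq_iff {s s' : S} {v v' : W} {b b' : Bool} {x y : List (S × W × Bool)}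
    {k : ℕ} (hx : k + 1 + x.length = n) (hxy : x.length = y.length) :
    pathTrace t n ((s, v, b) :: x) = pathTrace t n ((s', v', b') :: y) ↔
      s = s' ∧ b = b' ∧ t k v = t k v' ∧ pathTrace t n x = pathTrace t n y := by
  obtain rfl : k = n - (y.length + 1) := by omega
  simp only [pathTrace, hxy, List.cons.injEq, Prod.mk.injEq, Sigma.mk.injEq, true_and, and_assoc]
  rw [hxy, heq_iff_eq]

end Trace

theorem eq_of_suffix_of_length_eq {β : Type} {l l' c : List β} (h : l <:+ c) (h' : l' <:+ c)
    (hlen : l.length = l'.length) : l = l' :=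
  (List.suffix_of_suffix_length_le h h' hlen.le).eq_of_length hlen

theorem exists_cons_suffix {β : Type} {l c : List β} (h : l <:+ c) (hlen : l.length < c.length) :
    ∃ e, e :: l <:+ c := by
  obtain ⟨t, rfl⟩ := h
  rcases List.eq_nil_or_concat t with rfl | ⟨t, e, rfl⟩
  · simp at hlen
  · exact ⟨e, t, by simp⟩

/-- In the doubled unravelling, marking all lists with the same trace as the path `c` is
equivalent, up to depth `n` at the root, to marking `c` alone. -/
theorem depthType_unravel_trace (P : Set ℕ) (p n : ℕ) (t : (k : ℕ) → M.W → DepthType S P k)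
    (ht : t = depthType S P (M.update p ∅)) (c : List (S × M.W × Bool)) (hc : IsPath S M w c) :
    depthType S P ((unravel S M w).update p {l | pathTrace t n l = pathTrace t n c}) n
        ([] : List _) =
      depthType S P ((unravel S M w).update p {c}) n ([] : List _) := by
  have succ_step : ∀ {k : ℕ} {u u' : M.W}, t (k + 1) u = t (k + 1) u' → ∀ {a : A}, a ∈ S →
      ∀ {v : M.W}, M.R a u v → ∃ v' : M.W, M.R a u' v' ∧ t k v = t k v' := by
    subst ht
    intro k u u' h a ha v hv
    exact exists_of_depthType_eq h ha hv
  refine depthType_eq_of_bisim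
    (M := (unravel S M w).update p {l | pathTrace t n l = pathTrace t n c})
    (M' := (unravel S M w).update p {c})
    (fun k (x y : List (S × M.W × Bool)) => k + x.length = n ∧ x.length = y.length ∧
      t k (pathEnd S M w x) = t k (pathEnd S M w y) ∧
        (pathTrace t n x <:+ pathTrace t n c ↔ y <:+ c))
    ?_ ?_ ?_ n _ _ ⟨by simp, rfl, rfl, by simp [pathTrace]⟩
  · rintro k (x : List (S × M.W × Bool)) (y : List (S × M.W × Bool)) ⟨hk, hxy, hu, hs⟩ q hqP
    by_cases hq : q = p
    · subst hq
      refine (mem_update_self (unravel S M w) q _ x).trans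
        (Iff.trans ?_ (mem_update_self (unravel S M w) q _ y).symm)
      constructor
      · intro (h : pathTrace t n x = pathTrace t n c)
        have hl : x.length = c.length := by simpa using congrArg List.length h
        exact (hs.1 (h ▸ List.suffix_rfl)).eq_of_length (hxy ▸ hl)
      · intro (h : y = c)
        exact (hs.2 (h ▸ List.suffix_rfl)).eq_of_length (by simp [hxy, h])
    · subst ht
      refine (mem_update_of_ne (unravel S M w) hq _ x).trans
        (Iff.trans ?_ (mem_update_of_ne (unravel S M w) hq _ y).symm)
      exact (mem_update_of_ne M hq ∅ _).symm.trans
        ((mem_iff_of_depthType_eq hu hqP).trans (mem_update_of_ne M hq ∅ _))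
  · rintro k (x : List (S × M.W × Bool)) (y : List (S × M.W × Bool)) ⟨hk, hxy, hu, hs⟩ a -
      x' ⟨ha, v, b, hv, rfl⟩
    have hk' : k + (x.length + 1) = n := by omega
    have hxy' : x.length + 1 = y.length + 1 := by omega
    by_cases h : pathTrace t n ((⟨a, ha⟩, v, b) :: x) <:+ pathTrace t n c
    · have hx : pathTrace t n x <:+ pathTrace t n c := (List.suffix_cons _ _).trans h
      have hlen : y.length < c.length := by
        have := h.length_le
        simp only [length_pathTrace, List.length_cons] at this
        omega
      obtain ⟨⟨s, v', b'⟩, he⟩ := exists_cons_suffix (hs.1 hx) hlen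
      have e := eq_of_suffix_of_length_eq h (pathTrace_suffix t n he) (by simp [hxy])
      obtain ⟨rfl, rfl, e, -⟩ := (pathTrace_cons_eq_iff t n hk hxy).1 e
      exact ⟨(⟨a, ha⟩, v', b) :: y, ⟨ha, v', b, (hc.of_suffix he).1, rfl⟩, hk', hxy', e,
        iff_of_true h he⟩
    · obtain ⟨v', hv', e⟩ := succ_step hu ha hv
      obtain ⟨b', hb⟩ : ∃ b', ¬ ((⟨a, ha⟩, v', b') :: y <:+ c) := by
        by_contra! H
        have := eq_of_suffix_of_length_eq (H true) (H false) rfl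
        simp at this
      exact ⟨(⟨a, ha⟩, v', b') :: y, ⟨ha, v', b', hv', rfl⟩, hk', hxy', e, iff_of_false h hb⟩
  · rintro k (x : List (S × M.W × Bool)) (y : List (S × M.W × Bool)) ⟨hk, hxy, hu, hs⟩ a -
      y' ⟨ha, v, b, hv, rfl⟩
    have hk' : k + (x.length + 1) = n := by omega
    have hxy' : x.length + 1 = y.length + 1 := by omega
    obtain ⟨v', hv', e⟩ := succ_step hu.symm ha hv
    by_cases h : (⟨a, ha⟩, v, b) :: y <:+ c
    · have hy : y <:+ c := (List.suffix_cons _ _).trans h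
      have etr := eq_of_suffix_of_length_eq (hs.2 hy) (pathTrace_suffix t n hy) (by simp [hxy])
      have e' := (pathTrace_cons_eq_iff t n (s := ⟨a, ha⟩) (b := b) hk hxy).2
        ⟨rfl, rfl, e.symm, etr⟩
      exact ⟨(⟨a, ha⟩, v', b) :: x, ⟨ha, v', b, hv', rfl⟩, hk', hxy', e.symm,
        iff_of_true (e' ▸ pathTrace_suffix t n h) h⟩
    · obtain ⟨b', hb⟩ : ∃ b', ¬ (pathTrace t n ((⟨a, ha⟩, v', b') :: x) <:+
          pathTrace t n c) := by
        by_contra! H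
        have := eq_of_suffix_of_length_eq (H true) (H false) (by simp)
        simp [pathTrace] at this
      exact ⟨(⟨a, ha⟩, v', b') :: x, ⟨ha, v', b', hv', rfl⟩, hk', hxy', e.symm,
        iff_of_false hb h⟩

end Unravelling

/-! ### Complete additivity from finite additivity -/

theorem exists_singleton_of_finAdd_finite {A : Type} {φ : MF A} {p : ℕ}
    (h : FinAdd (fun W => Finite W) φ p) (M : KModel A) (hM : Finite M.W) (w : M.W)
    (hw : MSat M w φ) : ∃ v ∈ M.V p, MSat (M.update p {v}) w φ := by
  obtain ⟨v, hv⟩ := exists_fibre_of_union (fun X => MSat (M.update p X) w φ)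
    (fun X Y => (h.union M hM w X Y).1) (h.empty M hM w) id (M.V p) (Set.toFinite _)
    ((msat_update_self M p φ w).2 hw)
  have hvp : v ∈ M.V p := by
    by_contra hvp
    have e : {x ∈ M.V p | id x = v} = ∅ := by
      ext x; simp only [id, Set.mem_ofPred_eq, Set.mem_empty_iff_false, iff_false, not_and]
      rintro hx rfl; exact hvp hx
    rw [e] at hv
    exact h.empty M hM w hv
  exact ⟨v, hvp, h.mono M hM w (fun x hx => hx.2) hv⟩

theorem exists_singleton_of_finAdd {A : Type} {φ : MF A} {p : ℕ}
    (h : FinAdd (fun _ => True) φ p) (M : KModel A) (w : M.W)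
    (hw : MSat M w φ) : ∃ v ∈ M.V p, MSat (M.update p {v}) w φ := by
  set S := labelsMF φ
  set P := varsMF φ
  set n := depthMF φ
  have : Finite S := finite_labelsMF φ
  have : Finite P := finite_varsMF φ
  have := DepthType.finite S P
  let N := unravel S M w
  let r : N.W := ([] : List (S × M.W × Bool))
  have root : ∀ X : Set M.W,
      MSat (N.update p {l | pathEnd S M w l ∈ X ∧ IsPath S M w l ∧ l.length ≤ n}) r φ ↔
        MSat (M.update p X) w φ := fun X =>
    msat_iff_of_depthType_eq φ subset_rfl subset_rfl le_rfl (depthType_unravel P p n X)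
  let t : (k : ℕ) → M.W → DepthType S P k := depthType S P (M.update p ∅)
  let tr : N.W → List (S × Bool × (Σ k : Fin (n + 1), DepthType S P k)) := pathTrace t n
  obtain ⟨γ, hγ⟩ := exists_fibre_of_union (fun X => MSat (N.update p X) r φ)
    (fun X Y => (h.union N trivial r X Y).1) (h.empty N trivial r) tr
    {l | pathEnd S M w l ∈ M.V p ∧ IsPath S M w l ∧ l.length ≤ n}
    ((List.finite_length_le _ n).subset (by
      rintro _ ⟨l, ⟨-, -, hl⟩, rfl⟩
      exact (length_pathTrace t n l).trans_le hl))
    ((root _).2 ((msat_update_self M p φ w).2 hw))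
  obtain ⟨c, ⟨hcV, hcP, hcn⟩, rfl⟩ : {l : N.W | l ∈ {l : List (S × M.W × Bool) |
      pathEnd S M w l ∈ M.V p ∧ IsPath S M w l ∧ l.length ≤ n} ∧ tr l = γ}.Nonempty := by
    by_contra hne
    rw [Set.not_nonempty_iff_eq_empty] at hne
    exact h.empty N trivial r (hne ▸ hγ)
  refine ⟨pathEnd S M w c, hcV, (root _).1 ?_⟩
  have hC : MSat (N.update p {l | tr l = tr c}) r φ := h.mono N trivial r (fun l hl => hl.2) hγ
  have hsingle : MSat (N.update p {c}) r φ :=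
    (msat_iff_of_depthType_eq φ subset_rfl subset_rfl le_rfl
      (depthType_unravel_trace P p n t rfl c hcP)).1 hC
  refine h.mono N trivial r ?_ hsingle
  rintro _ rfl
  exact ⟨rfl, hcP, hcn⟩

/-- Proposition 2.7: complete additivity of `φ` in `p` is equivalent to the
validity of `φ[p/(q₁ ∨ q₂)] ↔ (φ[p/q₁] ∨ φ[p/q₂])` together with the validity of
`¬φ[p/⊥]`, for fresh distinct variables `q₁, q₂`; both over arbitrary Kripke
models and over finite Kripke models. -/
theorem compAdd_iff_valid {A : Type} (φ : MF A) (p q₁ q₂ : ℕ) (hq : q₁ ≠ q₂)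
    (h₁ : q₁ ∉ varsMF φ) (h₂ : q₂ ∉ varsMF φ) :
    (CompAdd φ p ↔
      (MValid (.and
          (.imp (substMF p (.or (.var q₁) (.var q₂)) φ)
                (.or (substMF p (.var q₁) φ) (substMF p (.var q₂) φ)))
          (.imp (.or (substMF p (.var q₁) φ) (substMF p (.var q₂) φ))
                (substMF p (.or (.var q₁) (.var q₂)) φ))) ∧
        MValid (.neg (substMF p .bot φ)))) ∧
    (CompAddFin φ p ↔
      (MValidFin (.and
          (.imp (substMF p (.or (.var q₁) (.var q₂)) φ)
                (.or (substMF p (.var q₁) φ) (substMF p (.var q₂) φ)))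
          (.imp (.or (substMF p (.var q₁) φ) (substMF p (.var q₂) φ))
                (substMF p (.or (.var q₁) (.var q₂)) φ))) ∧
        MValidFin (.neg (substMF p .bot φ)))) := by
  constructor
  · have e := finAdd_iff_valid (fun _ => True) φ p q₁ q₂ hq h₁ h₂
    simp only [forall_const] at e
    refine Iff.trans ?_ e
    refine ⟨fun h => finAdd_of_compAdd _ φ p (fun M _ => h.1 M) fun M _ => h.2 M,
      fun h => ⟨fun M w hw X hX => ?_, exists_singleton_of_finAdd h⟩⟩
    exact h.mono M trivial w hX ((msat_update_self M p φ w).2 hw)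
  · refine Iff.trans ?_ (finAdd_iff_valid (fun W => Finite W) φ p q₁ q₂ hq h₁ h₂)
    refine ⟨fun h => finAdd_of_compAdd _ φ p h.1 h.2,
      fun h => ⟨fun M hM w hw X hX => ?_, exists_singleton_of_finAdd_finite h⟩⟩
    exact h.mono M hM w hX ((msat_update_self M p φ w).2 hw)
end

section
/- For every modal formula φ and propositional variable p, φ is continuous in p if and only if φ is strongly continuous in p, i.e., φ is n-continuous in p for some natural number n. -/
/-- `φ` is continuous in `p`. -/
def ContIn {A : Type} (φ : MF A) (p : ℕ) : Prop :=
  ∀ (M : KModel A) (w : M.W),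
    MSat M w φ ↔ ∃ X : Set M.W, X ⊆ M.V p ∧ X.Finite ∧ MSat (M.update p X) w φ

/-- `φ` is `n`-continuous in `p`. -/
def NContIn {A : Type} (φ : MF A) (p : ℕ) (n : ℕ) : Prop :=
  ∀ (M : KModel A) (w : M.W),
    MSat M w φ ↔
      ∃ X : Set M.W, X ⊆ M.V p ∧ X.Finite ∧ X.ncard ≤ n ∧ MSat (M.update p X) w φ

open Filter in
/-- The ultraproduct of a family of Kripke models, before identifying worlds that agree
almost everywhere. -/
def KModel.preUltraproduct {A ι : Type} (U : Ultrafilter ι) (M : ι → KModel A) : KModel A where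
  W := ∀ i, (M i).W
  R a f g := ∀ᶠ i in (U : Filter ι), (M i).R a (f i) (g i)
  V q := {f | ∀ᶠ i in (U : Filter ι), f i ∈ (M i).V q}

open Filter in
/-- Łoś's theorem for modal formulas. -/
theorem mSat_preUltraproduct {A ι : Type} (U : Ultrafilter ι) (M : ι → KModel A) (φ : MF A)
    (f : ∀ i, (M i).W) :
    MSat (KModel.preUltraproduct U M) f φ ↔ ∀ᶠ i in (U : Filter ι), MSat (M i) (f i) φ := by
  induction φ generalizing f with
  | bot => simpa [MSat] using U.neBot.ne
  | var q => rfl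
  | neg φ ih => simp only [MSat, Ultrafilter.eventually_not, ih]
  | and φ ψ ihφ ihψ => simp only [MSat, eventually_and, ihφ, ihψ]
  | or φ ψ ihφ ihψ => simp only [MSat, Ultrafilter.eventually_or, ihφ, ihψ]
  | imp φ ψ ihφ ihψ => simp only [MSat, Ultrafilter.eventually_imp, ihφ, ihψ]
  | dia a φ ih =>
    constructor
    · rintro ⟨g, hR, hg⟩
      filter_upwards [hR, (ih g).1 hg] with i hi hi' using ⟨g i, hi, hi'⟩
    · intro h
      have key : ∀ i, ∃ v, (∃ v, (M i).R a (f i) v ∧ MSat (M i) v φ) →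
          (M i).R a (f i) v ∧ MSat (M i) v φ := fun i =>
        (em (∃ v, (M i).R a (f i) v ∧ MSat (M i) v φ)).elim
          (fun ⟨v, hv⟩ => ⟨v, fun _ => hv⟩) (fun hn => ⟨f i, fun hv => (hn hv).elim⟩)
      choose g hg using key
      exact ⟨g, h.mono fun i hi => (hg i hi).1, (ih g).2 (h.mono fun i hi => (hg i hi).2)⟩
  | box a φ ih =>
    constructor
    · intro h
      have key : ∀ i, ∃ v, ((M i).R a (f i) v → MSat (M i) v φ) →
          ∀ v, (M i).R a (f i) v → MSat (M i) v φ := fun i =>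
        (em (∀ v, (M i).R a (f i) v → MSat (M i) v φ)).elim
          (fun hv => ⟨f i, fun _ => hv⟩) (fun hn => by
            obtain ⟨v, hv⟩ := not_forall.1 hn
            exact ⟨v, fun hv' => (hv hv').elim⟩)
      choose g hg using key
      have hgU : ∀ᶠ i in (U : Filter ι), ((M i).R a (f i) (g i) → MSat (M i) (g i) φ) :=
        Ultrafilter.eventually_imp.2 fun hR => (ih g).1 (h g hR)
      exact hgU.mono hg
    · intro h g hR
      refine (ih g).2 ?_
      filter_upwards [h, hR] with i hi hi' using hi _ hi'

theorem mSat_congr_valuation {A W : Type} {R : A → W → W → Prop} {V V' : ℕ → Set W}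
    (h : V = V') (w : W) (φ : MF A) : MSat ⟨W, R, V⟩ w φ ↔ MSat ⟨W, R, V'⟩ w φ := by
  rw [h]

theorem mSat_update_update {A : Type} (M : KModel A) (p : ℕ) (X Y : Set M.W) (w : M.W)
    (φ : MF A) : MSat ((M.update p X).update p Y) w φ ↔ MSat (M.update p Y) w φ := by
  refine mSat_congr_valuation ?_ w φ
  funext q
  by_cases h : q = p <;> simp [KModel.update, h]

theorem KModel.update_V_self {A : Type} (M : KModel A) (p : ℕ) (X : Set M.W) :
    (M.update p X).V p = X :=
  if_pos rfl

theorem mSat_preUltraproduct_update {A ι : Type} (U : Ultrafilter ι) (M : ι → KModel A) (p : ℕ)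
    (X : ∀ i, Set (M i).W) (Y : Set (∀ i, (M i).W)) (w : ∀ i, (M i).W) (φ : MF A) :
    MSat ((KModel.preUltraproduct U fun i => (M i).update p (X i)).update p Y) w φ ↔
      MSat ((KModel.preUltraproduct U M).update p Y) w φ := by
  refine mSat_congr_valuation ?_ w φ
  funext q
  by_cases h : q = p <;> simp [KModel.update, KModel.preUltraproduct, h]

theorem NContIn.contIn {A : Type} {φ : MF A} {p n : ℕ} (h : NContIn φ p n) : ContIn φ p := by
  refine fun M w => ⟨fun hw => ?_, fun ⟨X, hX, _, hw⟩ => ?_⟩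
  · obtain ⟨X, hX, hfin, -, hs⟩ := (h M w).1 hw
    exact ⟨X, hX, hfin, hs⟩
  · obtain ⟨Y, hY, hfin, hcard, hs⟩ := (h (M.update p X) w).1 hw
    rw [KModel.update_V_self] at hY
    exact (h M w).2 ⟨Y, hY.trans hX, hfin, hcard, (mSat_update_update M p X Y w φ).1 hs⟩

open Filter in
theorem ContIn.exists_nContIn {A : Type} {φ : MF A} {p : ℕ} (h : ContIn φ p) :
    ∃ n, NContIn φ p n := by
  by_contra! hn
  have key : ∀ n, ∃ (M : KModel A) (w : M.W), MSat M w φ ∧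
      ∀ X : Set M.W, X ⊆ M.V p → X.Finite → X.ncard ≤ n → ¬ MSat (M.update p X) w φ := by
    intro n
    by_contra! hc
    refine hn n fun M w => ⟨fun hw => ?_, fun ⟨X, hX, hfin, _, hs⟩ => (h M w).2 ⟨X, hX, hfin, hs⟩⟩
    obtain ⟨X, hX, hfin, hcard, hs⟩ := hc M w hw
    exact ⟨X, hX, hfin, hcard, hs⟩
  choose M w hw hM using key
  let U : Ultrafilter ℕ := hyperfilter ℕ
  obtain ⟨X, hX, hfin, hs⟩ := (h (KModel.preUltraproduct U M) w).1
    ((mSat_preUltraproduct U M φ w).2 (Eventually.of_forall hw))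
  let Y : ∀ n, Set (M n).W := fun n => (fun f : ∀ i, (M i).W => f n) '' X
  let N : KModel A := KModel.preUltraproduct U fun n => (M n).update p (Y n)
  have hXN : X ⊆ N.V p := fun f hf => Eventually.of_forall fun n => by
    rw [KModel.update_V_self]
    exact ⟨f, hf, rfl⟩
  have hN : MSat N w φ :=
    (h N w).2 ⟨X, hXN, hfin, (mSat_preUltraproduct_update U M p Y X w φ).2 hs⟩
  have hsat := (mSat_preUltraproduct U (fun n => (M n).update p (Y n)) φ w).1 hN
  have hsub : ∀ᶠ n in (U : Filter ℕ), ∀ f ∈ X, f n ∈ (M n).V p :=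
    (eventually_all_finite hfin).2 fun f hf => hX hf
  have hlarge : ∀ᶠ n in (U : Filter ℕ), X.ncard ≤ n :=
    (eventually_ge_atTop X.ncard).filter_mono Nat.hyperfilter_le_atTop
  obtain ⟨n, hn₁, hn₂, hn₃⟩ := (hsat.and (hsub.and hlarge)).exists
  refine hM n (Y n) ?_ (hfin.image _) ((Set.ncard_image_le hfin).trans hn₃) hn₁
  rintro _ ⟨f, hf, rfl⟩
  exact hn₂ f hf

/-- Proposition 2.9: a modal formula is continuous in `p` iff it is strongly
continuous in `p`, i.e. `n`-continuous in `p` for some `n`. -/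
theorem continuous_iff_stronglyContinuous {A : Type} (φ : MF A) (p : ℕ) :
    ContIn φ p ↔ ∃ n : ℕ, NContIn φ p n :=
  ⟨ContIn.exists_nContIn, fun ⟨_, h⟩ => h.contIn⟩
end

section
/- Bisimulation Safety Theorem in the finite: a first-order formula φ(x,y), over a signature consisting of unary predicates P_p (one for each propositional variable p) and binary relations R_a (a∈A), is safe for bisimulation over finite Kripke models if and only if there is a modal program π such that φ(x,y) is equivalent over finite Kripke models to the standard translation ST_{x,y}(π). -/
open FirstOrder

/-- The relation symbols of the first-order signature of Kripke models:
a unary predicate `prop p` for each propositional variable `p : ℕ`, and a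
binary relation symbol `rel a` for each modality `a : A`. -/
inductive MRel (A : Type) : ℕ → Type
  | prop : ℕ → MRel A 1
  | rel : A → MRel A 2

/-- The first-order language of Kripke models. -/
def modalLang (A : Type) : Language :=
  { Functions := fun _ => Empty, Relations := MRel A }

/-- A Kripke model viewed as a first-order structure. -/
def kStruct {A : Type} (M : KModel A) : (modalLang A).Structure M.W where
  funMap := fun f _ => Empty.elim f
  RelMap := fun {n} r =>
    match n, r with
    | _, MRel.prop p => fun xs => xs 0 ∈ M.V p
    | _, MRel.rel a => fun xs => M.R a (xs 0) (xs 1)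

/-- Satisfaction of a first-order formula `φ(x,y)` in a Kripke model, with
`x := w` and `y := v`. -/
def FOSat {A : Type} (M : KModel A) (φ : (modalLang A).Formula (Fin 2))
    (w v : M.W) : Prop :=
  letI := kStruct M
  φ.Realize ![w, v]

/-- `Z` is a bisimulation between the Kripke models `M` and `M'`. -/
def IsBisim {A : Type} (M M' : KModel A) (Z : M.W → M'.W → Prop) : Prop :=
  (∀ w w', Z w w' → ∀ p : ℕ, (w ∈ M.V p ↔ w' ∈ M'.V p)) ∧
  (∀ (a : A) w w' v, Z w w' → M.R a w v → ∃ v', M'.R a w' v' ∧ Z v v') ∧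
  (∀ (a : A) w w' v', Z w w' → M'.R a w' v' → ∃ v, M.R a w v ∧ Z v v')

/-- `φ(x,y)` is safe for bisimulation over finite Kripke models. -/
def SafeForBisimFin {A : Type} (φ : (modalLang A).Formula (Fin 2)) : Prop :=
  ∀ (M M' : KModel A), Finite M.W → Finite M'.W →
    ∀ Z : M.W → M'.W → Prop, IsBisim M M' Z →
      (∀ w w' v, Z w w' → FOSat M φ w v → ∃ v', Z v v' ∧ FOSat M' φ w' v') ∧
      (∀ w w' v', Z w w' → FOSat M' φ w' v' → ∃ v, Z v v' ∧ FOSat M φ w v)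

/-- Modal programs. -/
inductive MProg (A : Type) : Type
  | test : ℕ → MProg A
  | atom : A → MProg A
  | comp : MProg A → MProg A → MProg A
  | union : MProg A → MProg A → MProg A
  | cneg : MProg A → MProg A

/-- The binary relation denoted by a modal program in a Kripke model; this is
exactly the relation defined by the standard translation `ST_{x,y}(π)`. -/
def progSem {A : Type} (M : KModel A) : MProg A → M.W → M.W → Prop
  | .test p, w, v => w = v ∧ w ∈ M.V p
  | .atom a, w, v => M.R a w v
  | .comp π ρ, w, v => ∃ u, progSem M π w u ∧ progSem M ρ u v
  | .union π ρ, w, v => progSem M π w v ∨ progSem M ρ w v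
  | .cneg π, w, v => w = v ∧ ¬ ∃ u, progSem M π w u

namespace KModel

variable {A : Type}

/-- Adjacency in the Gaifman graph of a Kripke model. -/
def Adj (M : KModel A) (x y : M.W) : Prop := ∃ a, M.R a x y ∨ M.R a y x

/-- `M.Near r x y`: the Gaifman distance of `x` and `y` is at most `r`. -/
def Near (M : KModel A) : ℕ → M.W → M.W → Prop
  | 0, x, y => x = y
  | r + 1, x, y => ∃ z, Near M r x z ∧ (z = y ∨ M.Adj z y)

variable {M : KModel A}

theorem Adj.symm {x y : M.W} (h : M.Adj x y) : M.Adj y x :=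
  let ⟨a, ha⟩ := h
  ⟨a, ha.symm⟩

theorem near_refl (x : M.W) : M.Near 0 x x := rfl

theorem Near.succ {r : ℕ} {x y : M.W} (h : M.Near r x y) : M.Near (r + 1) x y :=
  ⟨y, h, Or.inl rfl⟩

theorem Near.mono {r s : ℕ} {x y : M.W} (h : M.Near r x y) (hrs : r ≤ s) : M.Near s x y := by
  induction hrs with
  | refl => exact h
  | step _ ih => exact ih.succ

theorem Near.trans {r s : ℕ} {x y z : M.W} (h : M.Near r x y) (h' : M.Near s y z) :
    M.Near (r + s) x z := by
  induction s generalizing z with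
  | zero => obtain rfl : y = z := h'; exact h
  | succ s ih =>
    obtain ⟨u, hu, huz⟩ := h'
    exact ⟨u, ih hu, huz⟩

theorem near_one {x y : M.W} (h : x = y ∨ M.Adj x y) : M.Near 1 x y :=
  ⟨x, rfl, h⟩

theorem Near.symm {r : ℕ} {x y : M.W} (h : M.Near r x y) : M.Near r y x := by
  induction r generalizing y with
  | zero => exact Eq.symm h
  | succ r ih =>
    obtain ⟨z, hz, hzy⟩ := h
    have h1 : M.Near 1 y z := near_one (hzy.imp Eq.symm Adj.symm)
    exact (h1.trans (ih hz)).mono (by omega)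

/-- The disjoint union of `n` copies of a Kripke model. -/
def copies (n : ℕ) (K : KModel A) : KModel A where
  W := Fin n × K.W
  R a x y := x.1 = y.1 ∧ K.R a x.2 y.2
  V p := {x | x.2 ∈ K.V p}

theorem near_copies {n : ℕ} {K : KModel A} {r : ℕ} {x y : (K.copies n).W} :
    (K.copies n).Near r x y ↔ x.1 = y.1 ∧ K.Near r x.2 y.2 := by
  induction r generalizing y with
  | zero => exact Prod.ext_iff
  | succ r ih =>
    constructor
    · rintro ⟨z, hz, hzy⟩
      obtain ⟨h1, h2⟩ := ih.1 hz
      rcases hzy with rfl | ⟨a, ⟨e, h⟩ | ⟨e, h⟩⟩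
      · exact ⟨h1, _, h2, Or.inl rfl⟩
      · exact ⟨h1.trans e, _, h2, Or.inr ⟨a, Or.inl h⟩⟩
      · exact ⟨h1.trans e.symm, _, h2, Or.inr ⟨a, Or.inr h⟩⟩
    · rintro ⟨h1, z, hz, hzy⟩
      refine ⟨(x.1, z), ih.2 ⟨rfl, hz⟩, ?_⟩
      rcases hzy with h | ⟨a, h | h⟩
      · exact Or.inl (Prod.ext h1 h)
      · exact Or.inr ⟨a, Or.inl ⟨h1, h⟩⟩
      · exact Or.inr ⟨a, Or.inr ⟨h1.symm, h⟩⟩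

/-- `E` is a partial automorphism of `M` extending the finite correspondence `l`, whose domain and
range contain the `r`-neighbourhoods of the points of `l`. -/
structure LocalIso (M : KModel A) (r : ℕ) (l : List (M.W × M.W)) (E : M.W → M.W → Prop) :
    Prop where
  mem : ∀ p ∈ l, E p.1 p.2
  eq_iff : ∀ {x y x' y'}, E x y → E x' y' → (x = x' ↔ y = y')
  val_iff : ∀ {x y}, E x y → ∀ p, (x ∈ M.V p ↔ y ∈ M.V p)
  rel_iff : ∀ {x y x' y'}, E x y → E x' y' → ∀ a, (M.R a x x' ↔ M.R a y y')
  dom : ∀ p ∈ l, ∀ x, M.Near r p.1 x → ∃ y, E x y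
  cod : ∀ p ∈ l, ∀ y, M.Near r p.2 y → ∃ x, E x y

namespace LocalIso

variable {r : ℕ} {l : List (M.W × M.W)} {E : M.W → M.W → Prop}

theorem symm (h : M.LocalIso r l E) : M.LocalIso r (l.map Prod.swap) (flip E) where
  mem p hp := by
    obtain ⟨q, hq, rfl⟩ := List.mem_map.1 hp
    exact h.mem q hq
  eq_iff h1 h2 := (h.eq_iff h1 h2).symm
  val_iff h1 p := (h.val_iff h1 p).symm
  rel_iff h1 h2 a := (h.rel_iff h1 h2 a).symm
  dom p hp := by
    obtain ⟨q, hq, rfl⟩ := List.mem_map.1 hp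
    exact h.cod q hq
  cod p hp := by
    obtain ⟨q, hq, rfl⟩ := List.mem_map.1 hp
    exact h.dom q hq

theorem near_image (h : M.LocalIso r l E) {p : M.W × M.W} (hp : p ∈ l) {d : ℕ} (hd : d ≤ r)
    {x y : M.W} (hx : M.Near d p.1 x) (hxy : E x y) : M.Near d p.2 y := by
  induction d generalizing x y with
  | zero => exact (h.eq_iff (h.mem p hp) hxy).1 hx
  | succ d ih =>
    obtain ⟨z, hz, hzx⟩ := hx
    obtain ⟨z', hz'⟩ := h.dom p hp z (hz.mono (by omega))
    refine ⟨z', ih (by omega) hz hz', ?_⟩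
    rcases hzx with e | ⟨a, e | e⟩
    · exact Or.inl ((h.eq_iff hz' hxy).1 e)
    · exact Or.inr ⟨a, Or.inl ((h.rel_iff hz' hxy a).1 e)⟩
    · exact Or.inr ⟨a, Or.inr ((h.rel_iff hxy hz' a).1 e)⟩

theorem near_preimage (h : M.LocalIso r l E) {p : M.W × M.W} (hp : p ∈ l) {d : ℕ} (hd : d ≤ r)
    {x y : M.W} (hy : M.Near d p.2 y) (hxy : E x y) : M.Near d p.1 x :=
  h.symm.near_image (p := p.swap) (List.mem_map_of_mem hp) hd hy hxy

/-- A point far away from a local isomorphism may be matched with its clone in a fresh copy. -/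
theorem extend_far {n : ℕ} {K : KModel A} {r s : ℕ}
    {l : List ((K.copies n).W × (K.copies n).W)} {E : (K.copies n).W → (K.copies n).W → Prop}
    (h : (K.copies n).LocalIso s l E) (hrs : r ≤ s) {e : (K.copies n).W}
    (he : ∀ p ∈ l, ¬ (K.copies n).Near (2 * r + 1) p.1 e) {j : Fin n}
    (hj : ∀ p ∈ l, p.2.1 ≠ j) :
    ∃ E', (K.copies n).LocalIso r ((e, (j, e.2)) :: l) E' := by
  have far : ∀ p ∈ l, ∀ x x', (K.copies n).Near r p.1 x → (K.copies n).Near r e x' →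
      ¬ (x = x' ∨ (K.copies n).Adj x x') := by
    intro p hp x x' hx hx' hxx
    exact he p hp (((hx.trans (near_one hxx)).trans hx'.symm).mono (by omega))
  have off : ∀ p ∈ l, ∀ x y, (K.copies n).Near r p.1 x → E x y → y.1 ≠ j := by
    intro p hp x y hx hxy hy
    exact hj p hp ((near_copies.1 (h.near_image hp hrs hx hxy)).1.trans hy)
  have cp : ∀ x, (K.copies n).Near r e x → x.1 = e.1 := fun x hx => (near_copies.1 hx).1.symm
  refine ⟨fun x y => (E x y ∧ ∃ p ∈ l, (K.copies n).Near r p.1 x) ∨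
    ((K.copies n).Near r e x ∧ y = (j, x.2)), ?_, ?_, ?_, ?_, ?_, ?_⟩
  · intro p hp
    rcases List.mem_cons.1 hp with rfl | hp
    · exact Or.inr ⟨(near_refl _).mono (Nat.zero_le _), rfl⟩
    · exact Or.inl ⟨h.mem p hp, p, hp, (near_refl _).mono (Nat.zero_le _)⟩
  · rintro x y x' y' (⟨h1, p, hp, hx⟩ | ⟨hx, rfl⟩) (⟨h1', p', hp', hx'⟩ | ⟨hx', rfl⟩)
    · exact h.eq_iff h1 h1'
    · refine iff_of_false (fun c => far p hp x x' hx hx' (Or.inl c)) (fun c => ?_)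
      exact off p hp x y hx h1 (by rw [c])
    · refine iff_of_false (fun c => far p' hp' x' x hx' hx (Or.inl c.symm)) (fun c => ?_)
      exact off p' hp' x' y' hx' h1' (by rw [← c])
    · constructor
      · rintro rfl; rfl
      · intro c
        exact Prod.ext ((cp x hx).trans (cp x' hx').symm) (Prod.mk.inj c).2
  · rintro x y (⟨h1, -⟩ | ⟨hx, rfl⟩) q
    · exact h.val_iff h1 q
    · exact Iff.rfl
  · rintro x y x' y' (⟨h1, p, hp, hx⟩ | ⟨hx, rfl⟩) (⟨h1', p', hp', hx'⟩ | ⟨hx', rfl⟩) a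
    · exact h.rel_iff h1 h1' a
    · refine iff_of_false (fun c => far p hp x x' hx hx' (Or.inr ⟨a, Or.inl c⟩)) (fun c => ?_)
      exact off p hp x y hx h1 c.1
    · refine iff_of_false (fun c => far p' hp' x' x hx' hx (Or.inr ⟨a, Or.inr c⟩)) (fun c => ?_)
      exact off p' hp' x' y' hx' h1' c.1.symm
    · exact ⟨fun c => ⟨rfl, c.2⟩, fun c => ⟨(cp x hx).trans (cp x' hx').symm, c.2⟩⟩
  · intro p hp x hx
    rcases List.mem_cons.1 hp with rfl | hp
    · exact ⟨_, Or.inr ⟨hx, rfl⟩⟩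
    · obtain ⟨y, hy⟩ := h.dom p hp x (hx.mono hrs)
      exact ⟨y, Or.inl ⟨hy, p, hp, hx⟩⟩
  · intro p hp y hy
    rcases List.mem_cons.1 hp with rfl | hp
    · obtain ⟨h1, h2⟩ := near_copies.1 hy
      exact ⟨(e.1, y.2), Or.inr ⟨near_copies.2 ⟨rfl, h2⟩, Prod.ext h1.symm rfl⟩⟩
    · obtain ⟨x, hx⟩ := h.cod p hp y (hy.mono hrs)
      exact ⟨x, Or.inl ⟨hx, p, hp, h.near_preimage hp hrs hy hx⟩⟩

/-- The forth property of local isomorphisms in a union of sufficiently many copies. -/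
theorem forth {n : ℕ} {K : KModel A} {r : ℕ}
    {l : List ((K.copies n).W × (K.copies n).W)} {E : (K.copies n).W → (K.copies n).W → Prop}
    (h : (K.copies n).LocalIso (3 * r + 1) l E) (hl : l.length < n) (e : (K.copies n).W) :
    ∃ e' E', (K.copies n).LocalIso r ((e, e') :: l) E' := by
  by_cases he : ∃ p ∈ l, (K.copies n).Near (2 * r + 1) p.1 e
  · obtain ⟨p, hp, hpe⟩ := he
    obtain ⟨e', he'⟩ := h.dom p hp e (hpe.mono (by omega))
    have hpe' := h.near_image hp (by omega) hpe he'
    refine ⟨e', E, ?_, h.eq_iff, h.val_iff, h.rel_iff, ?_, ?_⟩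
    · intro q hq
      rcases List.mem_cons.1 hq with rfl | hq
      · exact he'
      · exact h.mem q hq
    · intro q hq x hx
      rcases List.mem_cons.1 hq with rfl | hq
      · exact h.dom p hp x ((hpe.trans hx).mono (by omega))
      · exact h.dom q hq x (hx.mono (by omega))
    · intro q hq x hx
      rcases List.mem_cons.1 hq with rfl | hq
      · exact h.cod p hp x ((hpe'.trans hx).mono (by omega))
      · exact h.cod q hq x (hx.mono (by omega))
  · push Not at he
    obtain ⟨j, hj⟩ : ∃ j : Fin n, j ∉ l.map (fun p => p.2.1) := by
      by_contra! hc
      have h1 : (Finset.univ : Finset (Fin n)) ⊆ (l.map (fun p => p.2.1)).toFinset :=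
        fun j _ => List.mem_toFinset.2 (hc j)
      have h2 := Finset.card_le_card h1
      have h3 := List.toFinset_card_le (l.map (fun p => p.2.1))
      rw [List.length_map] at h3
      rw [Finset.card_univ, Fintype.card_fin] at h2
      omega
    exact ⟨_, h.extend_far (by omega) he
      (fun p hp e => hj (List.mem_map.2 ⟨p, hp, e⟩))⟩

theorem back {n : ℕ} {K : KModel A} {r : ℕ}
    {l : List ((K.copies n).W × (K.copies n).W)} {E : (K.copies n).W → (K.copies n).W → Prop}
    (h : (K.copies n).LocalIso (3 * r + 1) l E) (hl : l.length < n) (e' : (K.copies n).W) :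
    ∃ e E', (K.copies n).LocalIso r ((e, e') :: l) E' := by
  obtain ⟨e, E', h'⟩ := h.symm.forth (by simpa using hl) e'
  exact ⟨e, flip E', by simpa using h'.symm⟩

end LocalIso

end KModel

/-- Quantifier rank. -/
def quantifierRank {L : Language} {α : Type} : {n : ℕ} → L.BoundedFormula α n → ℕ
  | _, .falsum => 0
  | _, .equal _ _ => 0
  | _, .rel _ _ => 0
  | _, .imp f g => max (quantifierRank f) (quantifierRank g)
  | _, .all f => quantifierRank f + 1

/-- The locality radius for formulas of quantifier rank `k`. -/
def localityRadius : ℕ → ℕ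
  | 0 => 0
  | k + 1 => 3 * localityRadius k + 1

/-- Realization of a bounded formula in a Kripke model. -/
def KModel.Sat {A : Type} (M : KModel A) {α : Type} {m : ℕ}
    (φ : (modalLang A).BoundedFormula α m) (v : α → M.W) (xs : Fin m → M.W) : Prop :=
  letI := kStruct M
  φ.Realize v xs

theorem exists_eq_var {A α : Type} (t : (modalLang A).Term α) : ∃ i, t = .var i := by
  cases t with
  | var i => exact ⟨i, rfl⟩
  | func f _ => exact Empty.elim f

theorem KModel.sat_equal {A α : Type} (M : KModel A) {m : ℕ} (i j : α ⊕ Fin m)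
    (v : α → M.W) (xs : Fin m → M.W) :
    M.Sat (.equal (.var i) (.var j)) v xs ↔ Sum.elim v xs i = Sum.elim v xs j := Iff.rfl

theorem KModel.sat_prop {A α : Type} (M : KModel A) {m : ℕ} (p : ℕ)
    (ts : Fin 1 → (modalLang A).Term (α ⊕ Fin m)) (i : α ⊕ Fin m) (hi : ts 0 = .var i)
    (v : α → M.W) (xs : Fin m → M.W) :
    M.Sat (.rel (MRel.prop p : (modalLang A).Relations 1) ts) v xs ↔
      Sum.elim v xs i ∈ M.V p := by
  let := kStruct M
  change (ts 0).realize (Sum.elim v xs) ∈ M.V p ↔ _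
  rw [hi]; rfl

theorem KModel.sat_rel {A α : Type} (M : KModel A) {m : ℕ} (a : A)
    (ts : Fin 2 → (modalLang A).Term (α ⊕ Fin m)) (i j : α ⊕ Fin m) (hi : ts 0 = .var i)
    (hj : ts 1 = .var j) (v : α → M.W) (xs : Fin m → M.W) :
    M.Sat (.rel (MRel.rel a : (modalLang A).Relations 2) ts) v xs ↔
      M.R a (Sum.elim v xs i) (Sum.elim v xs j) := by
  let := kStruct M
  change M.R a ((ts 0).realize (Sum.elim v xs)) ((ts 1).realize (Sum.elim v xs)) ↔ _
  rw [hi, hj]; rfl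

/-- Formulas of quantifier rank `k` do not distinguish tuples that are matched by a local
isomorphism of radius `localityRadius k`, in a union of sufficiently many copies. -/
theorem KModel.LocalIso.sat_iff {A : Type} {n : ℕ} {K : KModel A} {α : Type} {m : ℕ}
    (φ : (modalLang A).BoundedFormula α m) {k : ℕ} (hk : quantifierRank φ ≤ k)
    {l : List ((K.copies n).W × (K.copies n).W)} {E : (K.copies n).W → (K.copies n).W → Prop}
    (hl : l.length + k ≤ n) (h : (K.copies n).LocalIso (localityRadius k) l E)
    {v v' : α → (K.copies n).W} {xs xs' : Fin m → (K.copies n).W}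
    (hv : ∀ i, (v i, v' i) ∈ l) (hxs : ∀ i, (xs i, xs' i) ∈ l) :
    (K.copies n).Sat φ v xs ↔ (K.copies n).Sat φ v' xs' := by
  have hs : ∀ {m : ℕ} {l : List ((K.copies n).W × (K.copies n).W)}
      {E : (K.copies n).W → (K.copies n).W → Prop} {r : ℕ}
      {xs xs' : Fin m → (K.copies n).W}, (K.copies n).LocalIso r l E →
      (∀ i, (v i, v' i) ∈ l) → (∀ i, (xs i, xs' i) ∈ l) →
      ∀ i : α ⊕ Fin m, E (Sum.elim v xs i) (Sum.elim v' xs' i) := by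
    rintro m l E r xs xs' h hv hxs (i | i)
    · exact h.mem _ (hv i)
    · exact h.mem _ (hxs i)
  induction φ generalizing k l E with
  | falsum => exact Iff.rfl
  | equal t₁ t₂ =>
    obtain ⟨i, rfl⟩ := exists_eq_var t₁
    obtain ⟨j, rfl⟩ := exists_eq_var t₂
    rw [sat_equal, sat_equal]
    exact h.eq_iff (hs h hv hxs i) (hs h hv hxs j)
  | rel R ts =>
    cases R with
    | prop p =>
      obtain ⟨i, hi⟩ := exists_eq_var (ts 0)
      rw [sat_prop _ p ts i hi, sat_prop _ p ts i hi]
      exact h.val_iff (hs h hv hxs i) p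
    | rel a =>
      obtain ⟨i, hi⟩ := exists_eq_var (ts 0)
      obtain ⟨j, hj⟩ := exists_eq_var (ts 1)
      rw [sat_rel _ a ts i j hi hj, sat_rel _ a ts i j hi hj]
      exact h.rel_iff (hs h hv hxs i) (hs h hv hxs j) a
  | imp f g ihf ihg =>
    have hk' : max (quantifierRank f) (quantifierRank g) ≤ k := hk
    exact imp_congr (ihf (le_trans (le_max_left _ _) hk') hl h hv hxs)
      (ihg (le_trans (le_max_right _ _) hk') hl h hv hxs)
  | all f ih =>
    have hk' : quantifierRank f + 1 ≤ k := hk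
    obtain ⟨k, rfl⟩ : ∃ k', k = k' + 1 := ⟨k - 1, by omega⟩
    have key : ∀ e e' E', (K.copies n).LocalIso (localityRadius k) ((e, e') :: l) E' →
        ((K.copies n).Sat f v (Fin.snoc xs e) ↔ (K.copies n).Sat f v' (Fin.snoc xs' e')) := by
      intro e e' E' h'
      refine ih (by omega) (by simp only [List.length_cons]; omega) h'
        (fun i => List.mem_cons_of_mem _ (hv i)) (fun i => ?_)
      refine Fin.lastCases ?_ (fun i => ?_) i
      · simp
      · simpa using Or.inr (hxs i)
    constructor
    · intro hf e'
      obtain ⟨e, E', h'⟩ := h.back (by omega) e'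
      exact (key e e' E' h').1 (hf e)
    · intro hf e
      obtain ⟨e', E', h'⟩ := h.forth (by omega) e
      exact (key e e' E' h').2 (hf e')

theorem KModel.LocalIso.fosat_iff {A : Type} {n : ℕ} {K : KModel A}
    {φ : (modalLang A).Formula (Fin 2)} (hn : 2 + quantifierRank φ ≤ n)
    {l : List ((K.copies n).W × (K.copies n).W)} (hl : l.length ≤ 2)
    {E : (K.copies n).W → (K.copies n).W → Prop}
    (h : (K.copies n).LocalIso (localityRadius (quantifierRank φ)) l E)
    {x y x' y' : (K.copies n).W} (hx : (x, x') ∈ l) (hy : (y, y') ∈ l) :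
    FOSat (K.copies n) φ x y ↔ FOSat (K.copies n) φ x' y' := by
  refine h.sat_iff φ le_rfl (by omega) (v := ![x, y]) (v' := ![x', y']) (xs := default)
    (xs' := default) (fun i => ?_) (fun i => i.elim0)
  fin_cases i
  · exact hx
  · exact hy

theorem IsBisim.symm {A : Type} {M M' : KModel A} {Z : M.W → M'.W → Prop}
    (h : IsBisim M M' Z) : IsBisim M' M (flip Z) :=
  ⟨fun w w' hw p => (h.1 w' w hw p).symm, fun a w w' v hw => h.2.2 a w' w v hw,
    fun a w w' v hw => h.2.1 a w' w v hw⟩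

namespace KModel

variable {A : Type}

/-- All symbols outside of `S` and `P` are interpreted by the empty relation. -/
structure Supported (M : KModel A) (S : Finset A) (P : Finset ℕ) : Prop where
  rel : ∀ {a x y}, M.R a x y → a ∈ S
  val : ∀ {p x}, x ∈ M.V p → p ∈ P

/-- The codes for the possible bisimulation types of depth `n`, over the signature `S`, `P`. -/
def BisimType (S : Finset A) (P : Finset ℕ) : ℕ → Type
  | 0 => P → Prop
  | n + 1 => (P → Prop) × (S → BisimType S P n → Prop)

instance BisimType.finite (S : Finset A) (P : Finset ℕ) : ∀ n, Finite (BisimType S P n)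
  | 0 => inferInstanceAs (Finite (P → Prop))
  | n + 1 =>
    haveI := BisimType.finite S P n
    inferInstanceAs (Finite ((P → Prop) × (S → BisimType S P n → Prop)))

/-- The bisimulation type of depth `n` of a world. -/
def bisimType (S : Finset A) (P : Finset ℕ) (M : KModel A) : (n : ℕ) → M.W → BisimType S P n
  | 0, w => fun p => w ∈ M.V p
  | n + 1, w => (fun p => w ∈ M.V p, fun a t => ∃ v, M.R a w v ∧ bisimType S P M n v = t)

variable {S : Finset A} {P : Finset ℕ} {M M' : KModel A}

theorem val_iff_of_bisimType_eq {n : ℕ} {w : M.W} {w' : M'.W}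
    (h : M.bisimType S P n w = M'.bisimType S P n w') {p : ℕ} (hp : p ∈ P) :
    w ∈ M.V p ↔ w' ∈ M'.V p := by
  cases n with
  | zero => exact iff_of_eq (congrFun h ⟨p, hp⟩)
  | succ n => exact iff_of_eq (congrFun (congrArg Prod.fst h) ⟨p, hp⟩)

theorem forth_of_bisimType_eq {n : ℕ} {w : M.W} {w' : M'.W}
    (h : M.bisimType S P (n + 1) w = M'.bisimType S P (n + 1) w') (a : S) {v : M.W}
    (hv : M.R a w v) : ∃ v', M'.R a w' v' ∧ M.bisimType S P n v = M'.bisimType S P n v' := by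
  have h2 := congrFun (congrFun (congrArg Prod.snd h) a) (M.bisimType S P n v)
  obtain ⟨v', h1, h2⟩ := (iff_of_eq h2).1 ⟨v, hv, rfl⟩
  exact ⟨v', h1, h2.symm⟩

theorem bisimType_eq_of_succ {n : ℕ} {w : M.W} {w' : M'.W}
    (h : M.bisimType S P (n + 1) w = M'.bisimType S P (n + 1) w') :
    M.bisimType S P n w = M'.bisimType S P n w' := by
  induction n generalizing w w' with
  | zero => exact congrArg Prod.fst h
  | succ n ih =>
    refine Prod.ext (funext fun p => propext (val_iff_of_bisimType_eq h p.2)) ?_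
    funext a t
    refine propext ⟨?_, ?_⟩
    · rintro ⟨v, hv, rfl⟩
      obtain ⟨v', hv', e⟩ := forth_of_bisimType_eq h a hv
      exact ⟨v', hv', (ih e).symm⟩
    · rintro ⟨v', hv', rfl⟩
      obtain ⟨v, hv, e⟩ := forth_of_bisimType_eq h.symm a hv'
      exact ⟨v, hv, ih e.symm⟩

theorem bisimType_eq_mono {m n : ℕ} (hmn : m ≤ n) {w : M.W} {w' : M'.W}
    (h : M.bisimType S P n w = M'.bisimType S P n w') :
    M.bisimType S P m w = M'.bisimType S P m w' := by
  induction hmn with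
  | refl => exact h
  | step _ ih => exact ih (bisimType_eq_of_succ h)

/-- The last world of a path starting in `w`. Paths are stored with the most recent step first;
each step records a label, a bit, and the world reached. -/
def endpoint {M : KModel A} (w : M.W) : List (S × Bool × M.W) → M.W
  | [] => w
  | x :: _ => x.2.2

/-- All steps of the path are edges of the model. -/
def IsPath {M : KModel A} (w : M.W) : List (S × Bool × M.W) → Prop
  | [] => True
  | x :: l => IsPath w l ∧ M.R x.1 (endpoint w l) x.2.2

theorem IsPath.of_suffix {w : M.W} {l l' : List (S × Bool × M.W)} (h : IsPath w l')
    (hl : l <:+ l') : IsPath w l := by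
  induction l' with
  | nil => rw [List.suffix_nil.1 hl]; exact h
  | cons x l' ih =>
    rcases List.suffix_cons_iff.1 hl with rfl | hl
    · exact h
    · exact ih h.1 hl

/-- The unravelling of `M` at `w` up to depth `L`. The tree with tag `true` continues into `M`
beyond depth `L`, the tree with tag `false` is cut off. Every child occurs twice, told apart by
the bit of the last step. -/
def unravel (M : KModel A) (S : Finset A) (L : ℕ) (w : M.W) : KModel A where
  W := (Bool × {l : List (S × Bool × M.W) // l.length ≤ L}) ⊕ M.W
  R a x y :=
    match x, y with
    | .inl (c, l), .inl (c', l') =>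
      c = c' ∧ ∃ s b u, l'.1 = (s, b, u) :: l.1 ∧ s.1 = a ∧ M.R a (endpoint w l.1) u
    | .inl (c, l), .inr u => c = true ∧ l.1.length = L ∧ M.R a (endpoint w l.1) u
    | .inr _, .inl _ => False
    | .inr u, .inr u' => M.R a u u'
  V p := {x | Sum.elim (fun t => endpoint w t.2.1) id x ∈ M.V p}

instance finite_unravel [Finite M.W] {L : ℕ} {w : M.W} : Finite (M.unravel S L w).W := by
  have : Finite {l : List (S × Bool × M.W) // l.length ≤ L} := List.finite_length_le _ _
  exact inferInstanceAs
    (Finite ((Bool × {l : List (S × Bool × M.W) // l.length ≤ L}) ⊕ M.W))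

instance finite_copies {K : KModel A} [Finite K.W] {n : ℕ} : Finite (K.copies n).W :=
  inferInstanceAs (Finite (Fin n × K.W))

/-- The node of the unravelling given by the tag `c` and the path `l`. -/
def node {L : ℕ} {w : M.W} (c : Bool) (l : List (S × Bool × M.W)) (hl : l.length ≤ L) :
    (M.unravel S L w).W := Sum.inl (c, ⟨l, hl⟩)

theorem near_node {L : ℕ} {w : M.W} {c : Bool} {l₀ : List (S × Bool × M.W)}
    {hl₀ : l₀.length ≤ L} {d : ℕ} (hd : l₀.length + d ≤ L) {x : (M.unravel S L w).W}
    (hx : (M.unravel S L w).Near d (node c l₀ hl₀) x) :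
    ∃ l hl, x = node c l hl ∧ l.length ≤ l₀.length + d ∧ (IsPath w l₀ → IsPath w l) := by
  induction d generalizing x with
  | zero => exact ⟨l₀, hl₀, Eq.symm hx, le_rfl, id⟩
  | succ d ih =>
    obtain ⟨z, hz, hzx⟩ := hx
    obtain ⟨l, hl, rfl, hlen, hp⟩ := ih (by omega) hz
    rcases hzx with rfl | ⟨a, h | h⟩
    · exact ⟨l, hl, rfl, by omega, hp⟩
    · rcases x with ⟨c', l', hl'⟩ | u
      · obtain ⟨rfl, s, b, u, e, rfl, hR⟩ := h
        obtain rfl : l' = (s, b, u) :: l := e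
        exact ⟨_, hl', rfl, by simp only [List.length_cons]; omega, fun h0 => ⟨hp h0, hR⟩⟩
      · have h2 : l.length = L := h.2.1
        omega
    · rcases x with ⟨c', l', hl'⟩ | u
      · obtain ⟨rfl, s, b, u, e, rfl, hR⟩ := h
        obtain rfl : l = (s, b, u) :: l' := e
        simp only [List.length_cons] at hlen
        exact ⟨l', hl', rfl, by omega, fun h0 => (hp h0).1⟩
      · exact h.elim

/-- Close to the root, the full and the truncated unravelling are isomorphic. -/
theorem localIso_truncate {n L r : ℕ} {w : M.W} (i : Fin n) {l : List (S × Bool × M.W)}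
    (hl : l.length + r ≤ L) :
    ∃ E, ((M.unravel S L w).copies n).LocalIso r
      [((i, node true [] (Nat.zero_le L)), (i, node false [] (Nat.zero_le L))),
        ((i, node true l (by omega)), (i, node false l (by omega)))] E := by
  have cover : ∀ (c : Bool) (l₀ : List (S × Bool × M.W)) (hl₀ : l₀.length ≤ L),
      l₀.length + r ≤ L → ∀ x : ((M.unravel S L w).copies n).W,
      ((M.unravel S L w).copies n).Near r (i, node c l₀ hl₀) x →
      ∃ l' hl', x = (i, node c l' hl') := by
    intro c l₀ hl₀ hr x hx
    obtain ⟨h1, h2⟩ := near_copies.1 hx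
    obtain ⟨l', hl', e, -, -⟩ := near_node hr h2
    exact ⟨l', hl', Prod.ext h1.symm e⟩
  refine ⟨fun x y => ∃ l' hl', x = (i, node true l' hl') ∧ y = (i, node false l' hl'),
    ?_, ?_, ?_, ?_, ?_, ?_⟩
  · intro p hp
    simp only [List.mem_cons, List.not_mem_nil, or_false] at hp
    rcases hp with rfl | rfl
    · exact ⟨_, _, rfl, rfl⟩
    · exact ⟨_, _, rfl, rfl⟩
  · rintro _ _ _ _ ⟨l₁, h₁, rfl, rfl⟩ ⟨l₂, h₂, rfl, rfl⟩
    simp [node, unravel, copies]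
  · rintro _ _ ⟨l₁, h₁, rfl, rfl⟩ p
    exact Iff.rfl
  · rintro _ _ _ _ ⟨l₁, h₁, rfl, rfl⟩ ⟨l₂, h₂, rfl, rfl⟩ a
    simp [node, unravel, copies]
  · intro p hp x hx
    simp only [List.mem_cons, List.not_mem_nil, or_false] at hp
    rcases hp with rfl | rfl
    · obtain ⟨l', hl', rfl⟩ := cover true [] _ (by simp only [List.length_nil]; omega) x hx
      exact ⟨_, l', hl', rfl, rfl⟩
    · obtain ⟨l', hl', rfl⟩ := cover true l _ hl x hx
      exact ⟨_, l', hl', rfl, rfl⟩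
  · intro p hp x hx
    simp only [List.mem_cons, List.not_mem_nil, or_false] at hp
    rcases hp with rfl | rfl
    · obtain ⟨l', hl', rfl⟩ := cover false [] _ (by simp only [List.length_nil]; omega) x hx
      exact ⟨_, l', hl', rfl, rfl⟩
    · obtain ⟨l', hl', rfl⟩ := cover false l _ hl x hx
      exact ⟨_, l', hl', rfl, rfl⟩

/-- The projection of the full unravelling in copy `i` to the original model. -/
def Projects {n L : ℕ} {w : M.W} (i : Fin n) (x : ((M.unravel S L w).copies n).W) (y : M.W) :
    Prop :=
  (∃ l hl, x = (i, node true l hl) ∧ endpoint w l = y) ∨ x = (i, Sum.inr y)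

theorem Projects.endpoint_eq {n L : ℕ} {w : M.W} {i : Fin n} {l : List (S × Bool × M.W)}
    {hl : l.length ≤ L} {y : M.W}
    (h : Projects (w := w) i (i, node true l hl) y) : endpoint w l = y := by
  rcases h with ⟨l', hl', e, rfl⟩ | e
  · cases e; rfl
  · cases e

theorem isBisim_projects {n L : ℕ} {w : M.W} (i : Fin n) (hM : M.Supported S P) :
    IsBisim ((M.unravel S L w).copies n) M (Projects i) := by
  refine ⟨?_, ?_, ?_⟩
  · rintro x y (⟨l, hl, rfl, rfl⟩ | rfl) p <;> exact Iff.rfl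
  · rintro a x y ⟨j, v⟩ (⟨l, hl, rfl, rfl⟩ | rfl) ⟨e, hR⟩
    · obtain rfl : i = j := e
      rcases v with ⟨c', l', hl'⟩ | u
      · obtain ⟨rfl, s, b, u, e, rfl, hR⟩ := hR
        obtain rfl : l' = (s, b, u) :: l := e
        exact ⟨u, hR, Or.inl ⟨_, hl', rfl, rfl⟩⟩
      · exact ⟨u, hR.2.2, Or.inr rfl⟩
    · obtain rfl : i = j := e
      rcases v with ⟨c', l', hl'⟩ | u
      · exact hR.elim
      · exact ⟨u, hR, Or.inr rfl⟩
  · rintro a x y v (⟨l, hl, rfl, rfl⟩ | rfl) hR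
    · by_cases h : l.length = L
      · exact ⟨(i, Sum.inr v), ⟨rfl, rfl, h, hR⟩, Or.inr rfl⟩
      · have hl' : ((⟨a, hM.rel hR⟩, true, v) :: l : List (S × Bool × M.W)).length ≤ L := by
          simp only [List.length_cons]; omega
        exact ⟨(i, node true _ hl'), ⟨rfl, rfl, _, _, _, rfl, rfl, hR⟩,
          Or.inl ⟨_, hl', rfl, rfl⟩⟩
    · exact ⟨(i, Sum.inr v), ⟨rfl, hR⟩, Or.inr rfl⟩

theorem isBisim_copy {n : ℕ} {K : KModel A} (i : Fin n) :
    IsBisim (K.copies n) (K.copies n) (fun x y => x = y ∧ x.1 = i) := by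
  refine ⟨?_, ?_, ?_⟩
  · rintro w _ ⟨rfl, -⟩ p
    exact Iff.rfl
  · rintro a w _ v ⟨rfl, h⟩ hR
    exact ⟨v, hR, rfl, hR.1.symm.trans h⟩
  · rintro a w _ v ⟨rfl, h⟩ hR
    exact ⟨v, hR, rfl, hR.1.symm.trans h⟩

end KModel

open KModel

/-- If a safe formula holds at `(w, v)`, then it is witnessed by a short path in the truncated
unravelling. -/
theorem SafeForBisimFin.exists_path {A : Type} {φ : (modalLang A).Formula (Fin 2)}
    (hφ : SafeForBisimFin φ) {S : Finset A} {P : Finset ℕ} {M : KModel A} [Finite M.W]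
    (hM : M.Supported S P) {r L n : ℕ} (hr : r = localityRadius (quantifierRank φ))
    (hL : 3 * r + 1 ≤ L) (hn : 2 + quantifierRank φ ≤ n) (i j : Fin n) (hij : i ≠ j)
    {w v : M.W} (h : FOSat M φ w v) :
    ∃ (l : List (S × Bool × M.W)) (hl : l.length ≤ L), l.length ≤ 2 * r + 1 ∧ IsPath w l ∧
      endpoint w l = v ∧ FOSat ((M.unravel S L w).copies n) φ
        (i, node false [] (Nat.zero_le L)) (i, node false l hl) := by
  subst hr
  set r := localityRadius (quantifierRank φ)
  obtain ⟨x, hx, hsat⟩ := (hφ _ M inferInstance inferInstance _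
    (isBisim_projects (n := n) (L := L) (w := w) i hM)).2
    (i, node true [] (Nat.zero_le L)) w v (Or.inl ⟨[], Nat.zero_le L, rfl, rfl⟩) h
  have hxi : x.1 = i := by rcases hx with ⟨_, _, rfl, _⟩ | rfl <;> rfl
  by_cases hnear : ((M.unravel S L w).copies n).Near (2 * r + 1)
      (i, node true [] (Nat.zero_le L)) x
  · obtain ⟨l, hl, e, hlen, hp⟩ := near_node (by simp only [List.length_nil]; omega)
      (near_copies.1 hnear).2
    obtain rfl : x = (i, node true l hl) := Prod.ext hxi e
    simp only [List.length_nil, Nat.zero_add] at hlen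
    obtain ⟨E, hE⟩ := localIso_truncate (w := w) (r := r) (L := L) i (l := l) (by omega)
    exact ⟨l, hl, hlen, hp trivial, hx.endpoint_eq, (hE.fosat_iff hn le_rfl
      List.mem_cons_self (List.mem_cons_of_mem _ List.mem_cons_self)).1 hsat⟩
  · exfalso
    have hid : ((M.unravel S L w).copies n).LocalIso r
        [((i, node true [] (Nat.zero_le L)), (i, node true [] (Nat.zero_le L)))] Eq := by
      refine ⟨fun p hp => by rw [List.mem_singleton.1 hp], ?_, ?_, ?_, fun _ _ x _ => ⟨x, rfl⟩, fun _ _ x _ => ⟨x, rfl⟩⟩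
      · rintro x _ x' _ rfl rfl; exact Iff.rfl
      · rintro x _ rfl p; exact Iff.rfl
      · rintro x _ x' _ rfl rfl a; exact Iff.rfl
    obtain ⟨E, hE⟩ := hid.extend_far le_rfl (e := x) (j := j) (by simpa using hnear)
      (by simpa using hij)
    have h2 := (hE.fosat_iff hn le_rfl (x := (i, node true [] (Nat.zero_le L)))
      (x' := (i, node true [] (Nat.zero_le L))) (y := x) (y' := (j, x.2))
      (by simp) (by simp)).1 hsat
    obtain ⟨_, ⟨_, h3⟩, _⟩ := (hφ _ _ inferInstance inferInstance _ (isBisim_copy i)).1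
      _ _ _ ⟨rfl, rfl⟩ h2
    exact hij h3.symm

theorem SafeForBisimFin.of_path {A : Type} {φ : (modalLang A).Formula (Fin 2)}
    (hφ : SafeForBisimFin φ) {S : Finset A} {P : Finset ℕ} {M : KModel A} [Finite M.W]
    (hM : M.Supported S P) {r L n : ℕ} (hr : r = localityRadius (quantifierRank φ))
    (hn : 2 + quantifierRank φ ≤ n) (i : Fin n)
    {w : M.W} {l : List (S × Bool × M.W)} (hl : l.length + r ≤ L)
    (h : FOSat ((M.unravel S L w).copies n) φ
        (i, node false [] (Nat.zero_le L)) (i, node false l (by omega))) :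
    FOSat M φ w (endpoint w l) := by
  subst hr
  obtain ⟨E, hE⟩ := localIso_truncate (w := w) i hl
  have h1 := (hE.fosat_iff hn le_rfl
    List.mem_cons_self (List.mem_cons_of_mem _ List.mem_cons_self)).2 h
  obtain ⟨v, hv, hsat⟩ := (hφ _ M inferInstance inferInstance _
    (isBisim_projects (n := n) (L := L) (w := w) i hM)).1 _ w _
    (Or.inl ⟨[], Nat.zero_le L, rfl, rfl⟩) h1
  rwa [hv.endpoint_eq]

theorem List.eq_of_suffix_of_length_eq {α : Type} {l₁ l₂ l : List α} (h₁ : l₁ <:+ l)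
    (h₂ : l₂ <:+ l) (h : l₁.length = l₂.length) : l₁ = l₂ :=
  (List.suffix_of_suffix_length_le h₁ h₂ h.le).eq_of_length h

theorem List.Forall₂.exists_of_cons_suffix {α β : Type} {Q : α → β → Prop} {l : List α}
    {l' : List β} (h : List.Forall₂ Q l l') {x : α} {k : List α} (hk : x :: k <:+ l) :
    ∃ x' k', x' :: k' <:+ l' ∧ Q x x' ∧ k.length = k'.length := by
  induction h with
  | nil => exact absurd (List.suffix_nil.1 hk) (List.cons_ne_nil _ _)
  | cons hQ hl ih =>
    rcases List.suffix_cons_iff.1 hk with e | hk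
    · obtain ⟨rfl, rfl⟩ := List.cons.inj e
      exact ⟨_, _, List.suffix_rfl, hQ, hl.length_eq⟩
    · obtain ⟨x', k', h1, h2⟩ := ih hk
      exact ⟨x', k', h1.trans (List.suffix_cons _ _), h2⟩

namespace KModel

variable {A : Type} {S : Finset A} {P : Finset ℕ} {M M' : KModel A}

/-- Two steps have the same label and lead to worlds of the same bisimulation type. -/
def StepMatch (P : Finset ℕ) (L : ℕ) (x : S × Bool × M.W) (y : S × Bool × M'.W) : Prop :=
  x.1 = y.1 ∧ M.bisimType S P L x.2.2 = M'.bisimType S P L y.2.2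

/-- The bisimulation between truncated unravellings that respects two distinguished branches. -/
def BranchRel (P : Finset ℕ) {n L : ℕ} (i : Fin n) {w : M.W} {w' : M'.W}
    (l : List (S × Bool × M.W)) (l' : List (S × Bool × M'.W))
    (x : ((M.unravel S L w).copies n).W) (y : ((M'.unravel S L w').copies n).W) : Prop :=
  ∃ k hk k' hk', x = (i, node false k hk) ∧ y = (i, node false k' hk') ∧
    k.length = k'.length ∧ (k <:+ l ↔ k' <:+ l') ∧
    M.bisimType S P (L - k.length) (endpoint w k) =
      M'.bisimType S P (L - k.length) (endpoint w' k')

theorem BranchRel.symm {n L : ℕ} {i : Fin n} {w : M.W} {w' : M'.W}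
    {l : List (S × Bool × M.W)} {l' : List (S × Bool × M'.W)}
    {x : ((M.unravel S L w).copies n).W} {y : ((M'.unravel S L w').copies n).W}
    (h : BranchRel P i l l' x y) : BranchRel P i l' l y x := by
  obtain ⟨k, hk, k', hk', rfl, rfl, h1, h2, h3⟩ := h
  exact ⟨k', hk', k, hk, rfl, rfl, h1.symm, h2.symm, by rw [← h1]; exact h3.symm⟩

theorem BranchRel.forth {n L : ℕ} {i : Fin n} {w : M.W} {w' : M'.W}
    {l : List (S × Bool × M.W)} {l' : List (S × Bool × M'.W)}
    (hl' : IsPath w' l') (hll : List.Forall₂ (StepMatch P L) l l')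
    {x v : ((M.unravel S L w).copies n).W} {y : ((M'.unravel S L w').copies n).W}
    (h : BranchRel P i l l' x y) {a : A} (hR : ((M.unravel S L w).copies n).R a x v) :
    ∃ v', ((M'.unravel S L w').copies n).R a y v' ∧ BranchRel P i l l' v v' := by
  obtain ⟨k, hk, k', hk', rfl, rfl, hlen, hsuf, htp⟩ := h
  obtain ⟨j, v⟩ := v
  obtain ⟨e, hR⟩ := hR
  obtain rfl : i = j := e
  rcases v with ⟨c, m, hm⟩ | u
  swap
  · exact absurd hR.1 Bool.false_ne_true
  obtain ⟨rfl, s, b, u, e, rfl, hR⟩ := hR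
  obtain rfl : m = (s, b, u) :: k := e
  have hm' : k.length + 1 ≤ L := hm
  by_cases hs : (s, b, u) :: k <:+ l
  · obtain ⟨x', m', hx', ⟨hlab, hxtp⟩, hmlen⟩ := hll.exists_of_cons_suffix hs
    have hk's : k' <:+ l' := hsuf.1 ((List.suffix_cons _ _).trans hs)
    obtain rfl : m' = k' := List.eq_of_suffix_of_length_eq
      ((List.suffix_cons _ _).trans hx') hk's (hmlen.symm.trans hlen)
    obtain ⟨s', b', u'⟩ := x'
    obtain rfl : s = s' := hlab
    have hlen' : ((s, b', u') :: m').length ≤ L := by simp only [List.length_cons]; omega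
    refine ⟨(i, node false ((s, b', u') :: m') hlen'),
      ⟨rfl, rfl, s, b', u', rfl, rfl, (hl'.of_suffix hx').2⟩,
      _, hm, _, hlen', rfl, rfl, by simp [hlen], iff_of_true hs hx', ?_⟩
    exact bisimType_eq_mono (Nat.sub_le _ _) hxtp
  · obtain ⟨d, hd⟩ : ∃ d, L - k.length = d + 1 := ⟨L - k.length - 1, by omega⟩
    rw [hd] at htp
    obtain ⟨u', hu', hutp⟩ := forth_of_bisimType_eq htp s hR
    obtain ⟨b', hb'⟩ : ∃ b', ¬ ((s, b', u') :: k' <:+ l') := by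
      by_contra! hc
      have := List.eq_of_suffix_of_length_eq (hc true) (hc false) rfl
      simp at this
    have hlen' : ((s, b', u') :: k').length ≤ L := by simp only [List.length_cons]; omega
    refine ⟨(i, node false ((s, b', u') :: k') hlen'),
      ⟨rfl, rfl, s, b', u', rfl, rfl, hu'⟩,
      _, hm, _, hlen', rfl, rfl, by simp [hlen], iff_of_false hs hb', ?_⟩
    have : L - ((s, b, u) :: k).length = d := by simp only [List.length_cons]; omega
    rw [this]
    exact hutp

theorem isBisim_branchRel {n L : ℕ} (i : Fin n) {w : M.W} {w' : M'.W}
    (hM : M.Supported S P) (hM' : M'.Supported S P)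
    {l : List (S × Bool × M.W)} {l' : List (S × Bool × M'.W)}
    (hl : IsPath w l) (hl' : IsPath w' l') (hll : List.Forall₂ (StepMatch P L) l l') :
    IsBisim ((M.unravel S L w).copies n) ((M'.unravel S L w').copies n)
      (BranchRel P i l l') := by
  refine ⟨?_, fun a x y v h hR => h.forth hl' hll hR, fun a x y v h hR => ?_⟩
  · rintro x y ⟨k, hk, k', hk', rfl, rfl, -, -, htp⟩ p
    change endpoint w k ∈ M.V p ↔ endpoint w' k' ∈ M'.V p
    by_cases hp : p ∈ P
    · exact val_iff_of_bisimType_eq htp hp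
    · exact iff_of_false (fun c => hp (hM.val c)) (fun c => hp (hM'.val c))
  · have hll' : List.Forall₂ (StepMatch P L) l' l :=
      hll.flip.imp fun _ _ h => ⟨h.1.symm, h.2.symm⟩
    obtain ⟨v', h1, h2⟩ := h.symm.forth hl hll' hR
    exact ⟨v', h1, h2.symm⟩

end KModel

/-- The truth of a safe formula transfers along paths that match step by step. -/
theorem SafeForBisimFin.transfer {A : Type} {φ : (modalLang A).Formula (Fin 2)}
    (hφ : SafeForBisimFin φ) {S : Finset A} {P : Finset ℕ} {M : KModel A} [Finite M.W]
    (hM : M.Supported S P) {r L : ℕ} (hr : r = localityRadius (quantifierRank φ))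
    (hL : 3 * r + 1 ≤ L) {w v : M.W} (h : FOSat M φ w v) :
    ∃ l : List (S × Bool × M.W), l.length ≤ 2 * r + 1 ∧ IsPath w l ∧ endpoint w l = v ∧
      ∀ (M' : KModel A) (w' : M'.W) (l' : List (S × Bool × M'.W)), Finite M'.W →
        M'.Supported S P → IsPath w' l' → List.Forall₂ (StepMatch P L) l l' →
        M.bisimType S P L w = M'.bisimType S P L w' → FOSat M' φ w' (endpoint w' l') := by
  obtain ⟨l, hlL, hlen, hl, hend, hsat⟩ := hφ.exists_path hM hr hL
    (n := 2 + quantifierRank φ) le_rfl ⟨0, by omega⟩ ⟨1, by omega⟩ (by simp) h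
  refine ⟨l, hlen, hl, hend, fun M' w' l' hfin hM' hl' hll hw => ?_⟩
  have hlen' := hll.length_eq
  refine hφ.of_path hM' hr le_rfl ⟨0, by omega⟩ (L := L) (by omega) ?_
  obtain ⟨y, hy, hsat'⟩ := (hφ _ _ inferInstance inferInstance _
    (isBisim_branchRel ⟨0, by omega⟩ hM hM' hl hl' hll)).1 _
    (⟨0, by omega⟩, node false [] (Nat.zero_le L)) _
    ⟨[], Nat.zero_le L, [], Nat.zero_le L, rfl, rfl, rfl,
      iff_of_true List.nil_suffix List.nil_suffix, hw⟩ hsat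
  obtain ⟨k, hk, k', hk', e, rfl, h1, h2, -⟩ := hy
  cases e
  obtain rfl : k' = l' := List.eq_of_suffix_of_length_eq (h2.1 List.suffix_rfl)
    List.suffix_rfl (h1.symm.trans hlen')
  exact hsat'

namespace KModel

variable {A : Type}

/-- The Kripke model in which all symbols outside of `S` and `P` are made empty. -/
def restrict_s7 (S : Finset A) (P : Finset ℕ) (M : KModel A) : KModel A where
  W := M.W
  R a x y := a ∈ S ∧ M.R a x y
  V p := {x | p ∈ P ∧ x ∈ M.V p}

theorem supported_restrict (S : Finset A) (P : Finset ℕ) (M : KModel A) :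
    (M.restrict_s7 S P).Supported S P := ⟨And.left, And.left⟩

/-- A formula only depends on finitely many symbols. -/
theorem exists_sat_restrict_iff {α : Type} {m : ℕ} (φ : (modalLang A).BoundedFormula α m) :
    ∃ S₀ P₀, ∀ S P, S₀ ⊆ S → P₀ ⊆ P → ∀ (M : KModel A) (v : α → M.W) (xs : Fin m → M.W),
      (M.restrict_s7 S P).Sat φ v xs ↔ M.Sat φ v xs := by
  classical
  induction φ with
  | falsum => exact ⟨∅, ∅, fun _ _ _ _ _ _ _ => Iff.rfl⟩
  | equal t₁ t₂ =>
    obtain ⟨i, rfl⟩ := exists_eq_var t₁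
    obtain ⟨j, rfl⟩ := exists_eq_var t₂
    exact ⟨∅, ∅, fun _ _ _ _ _ _ _ => Iff.rfl⟩
  | rel R ts =>
    cases R with
    | prop p =>
      obtain ⟨i, hi⟩ := exists_eq_var (ts 0)
      refine ⟨∅, {p}, fun S P _ hP M v xs => ?_⟩
      refine (sat_prop (M.restrict_s7 S P) p ts i hi v xs).trans
        (Iff.trans ?_ (sat_prop M p ts i hi v xs).symm)
      exact ⟨And.right, fun h => ⟨hP (Finset.mem_singleton_self p), h⟩⟩
    | rel a =>
      obtain ⟨i, hi⟩ := exists_eq_var (ts 0)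
      obtain ⟨j, hj⟩ := exists_eq_var (ts 1)
      refine ⟨{a}, ∅, fun S P hS _ M v xs => ?_⟩
      refine (sat_rel (M.restrict_s7 S P) a ts i j hi hj v xs).trans
        (Iff.trans ?_ (sat_rel M a ts i j hi hj v xs).symm)
      exact ⟨And.right, fun h => ⟨hS (Finset.mem_singleton_self a), h⟩⟩
  | imp f g ihf ihg =>
    obtain ⟨S₁, P₁, h₁⟩ := ihf
    obtain ⟨S₂, P₂, h₂⟩ := ihg
    refine ⟨S₁ ∪ S₂, P₁ ∪ P₂, fun S P hS hP M v xs => imp_congr ?_ ?_⟩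
    · exact h₁ S P (Finset.union_subset_left hS) (Finset.union_subset_left hP) M v xs
    · exact h₂ S P (Finset.union_subset_right hS) (Finset.union_subset_right hP) M v xs
  | all f ih =>
    obtain ⟨S₀, P₀, h⟩ := ih
    exact ⟨S₀, P₀, fun S P hS hP M v xs => forall_congr' fun e => h S P hS hP M v _⟩

/-- `Q` is a binary relation on all models, definable by a program. -/
def ProgDef (Q : ∀ M : KModel A, M.W → M.W → Prop) : Prop :=
  ∃ π, ∀ (M : KModel A) (w v : M.W), progSem M π w v ↔ Q M w v

/-- `Q` is a property of worlds, definable by a program acting as a test. -/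
def TestDef (Q : ∀ M : KModel A, M.W → Prop) : Prop :=
  ProgDef fun M w v => w = v ∧ Q M w

theorem ProgDef.congr {Q Q' : ∀ M : KModel A, M.W → M.W → Prop} (h : ProgDef Q)
    (e : ∀ M w v, Q M w v ↔ Q' M w v) : ProgDef Q' :=
  let ⟨π, hπ⟩ := h
  ⟨π, fun M w v => (hπ M w v).trans (e M w v)⟩

theorem TestDef.congr {Q Q' : ∀ M : KModel A, M.W → Prop} (h : TestDef Q)
    (e : ∀ M w, Q M w ↔ Q' M w) : TestDef Q' :=
  ProgDef.congr h fun M w _ => and_congr_right fun _ => e M w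

theorem ProgDef.comp {Q Q' : ∀ M : KModel A, M.W → M.W → Prop} (h : ProgDef Q)
    (h' : ProgDef Q') : ProgDef fun M w v => ∃ u, Q M w u ∧ Q' M u v := by
  obtain ⟨π, hπ⟩ := h
  obtain ⟨ρ, hρ⟩ := h'
  exact ⟨.comp π ρ, fun M w v => exists_congr fun u => and_congr (hπ M w u) (hρ M u v)⟩

theorem ProgDef.or {Q Q' : ∀ M : KModel A, M.W → M.W → Prop} (h : ProgDef Q)
    (h' : ProgDef Q') : ProgDef fun M w v => Q M w v ∨ Q' M w v := by
  obtain ⟨π, hπ⟩ := h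
  obtain ⟨ρ, hρ⟩ := h'
  exact ⟨.union π ρ, fun M w v => or_congr (hπ M w v) (hρ M w v)⟩

theorem ProgDef.testDef_not_exists {Q : ∀ M : KModel A, M.W → M.W → Prop} (h : ProgDef Q) :
    TestDef fun M w => ¬ ∃ u, Q M w u := by
  obtain ⟨π, hπ⟩ := h
  exact ⟨.cneg π, fun M w v =>
    and_congr_right fun _ => not_congr (exists_congr fun u => hπ M w u)⟩

theorem TestDef.not {Q : ∀ M : KModel A, M.W → Prop} (h : TestDef Q) :
    TestDef fun M w => ¬ Q M w :=
  (ProgDef.testDef_not_exists h).congr fun _ w =>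
    not_congr ⟨fun ⟨_, _, h⟩ => h, fun h => ⟨w, rfl, h⟩⟩

theorem ProgDef.testDef_exists {Q : ∀ M : KModel A, M.W → M.W → Prop} (h : ProgDef Q) :
    TestDef fun M w => ∃ u, Q M w u :=
  h.testDef_not_exists.not.congr fun _ _ => not_not

theorem TestDef.and {Q Q' : ∀ M : KModel A, M.W → Prop} (h : TestDef Q)
    (h' : TestDef Q') : TestDef fun M w => Q M w ∧ Q' M w :=
  (ProgDef.comp h h').congr fun M w v => by
    constructor
    · rintro ⟨u, ⟨rfl, h1⟩, rfl, h2⟩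
      exact ⟨rfl, h1, h2⟩
    · rintro ⟨rfl, h1, h2⟩
      exact ⟨w, ⟨rfl, h1⟩, rfl, h2⟩

theorem testDef_prop (p : ℕ) : TestDef fun (M : KModel A) w => w ∈ M.V p :=
  ⟨.test p, fun _ _ _ => Iff.rfl⟩

theorem testDef_false : TestDef fun (M : KModel A) (_ : M.W) => False :=
  ((testDef_prop 0).and (testDef_prop 0).not).congr fun M w => by simp

theorem testDef_true : TestDef fun (M : KModel A) (_ : M.W) => True :=
  testDef_false.not.congr fun M w => by simp

theorem progDef_false : ProgDef fun (M : KModel A) (_ _ : M.W) => False :=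
  ProgDef.congr testDef_false fun M w v => by simp

theorem TestDef.iff_const {Q : ∀ M : KModel A, M.W → Prop} (h : TestDef Q) (c : Prop) :
    TestDef fun M w => (Q M w ↔ c) := by
  by_cases hc : c
  · exact h.congr fun M w => by simp [hc]
  · exact h.not.congr fun M w => by simp [hc]

theorem testDef_forall {ι : Type} [Finite ι] {Q : ι → ∀ M : KModel A, M.W → Prop}
    (h : ∀ i, TestDef (Q i)) : TestDef fun M w => ∀ i, Q i M w := by
  classical
  have := Fintype.ofFinite ι
  have key : ∀ s : Finset ι, TestDef fun M w => ∀ i ∈ s, Q i M w := by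
    intro s
    induction s using Finset.induction_on with
    | empty => exact testDef_true.congr fun M w => by simp
    | insert i s _ ih => exact ((h i).and ih).congr fun M w => by simp
  exact (key Finset.univ).congr fun M w => by simp

theorem progDef_exists_mem {ι : Type} {G : Set ι} (hG : G.Finite)
    {Q : ι → ∀ M : KModel A, M.W → M.W → Prop} (h : ∀ i, ProgDef (Q i)) :
    ProgDef fun M w v => ∃ i ∈ G, Q i M w v := by
  induction G, hG using Set.Finite.induction_on with
  | empty => exact progDef_false.congr fun M w v => by simp
  | @insert i s _ _ ih => exact ((h i).or ih).congr fun M w v => by simp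

variable {S : Finset A} {P : Finset ℕ}

theorem testDef_bisimType (n : ℕ) (t : BisimType S P n) :
    TestDef fun M w => (M.restrict_s7 S P).bisimType S P n w = t := by
  have hval : ∀ c : P → Prop, TestDef fun (M : KModel A) w =>
      ∀ p : P, (w ∈ (M.restrict_s7 S P).V p ↔ c p) := fun c =>
    testDef_forall fun p => ((testDef_prop p).congr fun M w =>
      ⟨fun h => ⟨p.2, h⟩, And.right⟩).iff_const (c p)
  induction n with
  | zero => exact (hval t).congr fun M w =>
      ⟨fun h => funext fun p => propext (h p), fun h p => iff_of_eq (congrFun h p)⟩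
  | succ n ih =>
    have hdia : ∀ (a : S) (t' : BisimType S P n), TestDef fun (M : KModel A) w =>
        ∃ v, (M.restrict_s7 S P).R a w v ∧ (M.restrict_s7 S P).bisimType S P n v = t' := by
      intro a t'
      have ha : ProgDef fun (M : KModel A) w v => (M.restrict_s7 S P).R a w v :=
        ⟨.atom a, fun M w v => ⟨fun h => ⟨a.2, h⟩, And.right⟩⟩
      refine (ha.comp (ih t')).testDef_exists.congr fun M w => ?_
      constructor
      · rintro ⟨_, u, h1, rfl, h2⟩
        exact ⟨u, h1, h2⟩
      · rintro ⟨u, h1, h2⟩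
        exact ⟨u, u, h1, rfl, h2⟩
    refine ((hval t.1).and (testDef_forall fun a => testDef_forall fun t' =>
      (hdia a t').iff_const (t.2 a t'))).congr fun M w => ?_
    constructor
    · rintro ⟨h1, h2⟩
      exact Prod.ext (funext fun p => propext (h1 p))
        (funext fun a => funext fun t' => propext (h2 a t'))
    · rintro rfl
      exact ⟨fun _ => Iff.rfl, fun _ _ => Iff.rfl⟩

/-- `v` can be reached from `w` by a path whose labels and bisimulation types are prescribed. -/
def PathType (M : KModel A) {L : ℕ} (t : BisimType S P L) :
    List (S × BisimType S P L) → M.W → M.W → Prop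
  | [], w, v => w = v ∧ M.bisimType S P L w = t
  | x :: τ, w, v => ∃ u, PathType M t τ w u ∧ M.R x.1 u v ∧ M.bisimType S P L v = x.2

theorem progDef_pathType {L : ℕ} (t : BisimType S P L) (τ : List (S × BisimType S P L)) :
    ProgDef fun M w v => (M.restrict_s7 S P).PathType t τ w v := by
  induction τ with
  | nil => exact testDef_bisimType L t
  | cons x τ ih =>
    have ha : ProgDef fun (M : KModel A) w v => (M.restrict_s7 S P).R x.1 w v :=
      ⟨.atom x.1, fun M w v => ⟨fun h => ⟨x.1.2, h⟩, And.right⟩⟩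
    refine (ih.comp (ha.comp (testDef_bisimType L x.2))).congr fun M w v => ?_
    constructor
    · rintro ⟨u, h1, _, h2, rfl, h3⟩
      exact ⟨u, h1, h2, h3⟩
    · rintro ⟨u, h1, h2, h3⟩
      exact ⟨u, h1, v, h2, rfl, h3⟩

theorem pathType_endpoint {M : KModel A} {L : ℕ} {w : M.W} {l : List (S × Bool × M.W)}
    (hl : IsPath w l) : M.PathType (M.bisimType S P L w)
      (l.map fun x => (x.1, M.bisimType S P L x.2.2)) w (endpoint w l) := by
  induction l with
  | nil => exact ⟨rfl, rfl⟩
  | cons x l ih => exact ⟨_, ih hl.1, hl.2, rfl⟩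

theorem PathType.exists_path {M M' : KModel A} {L : ℕ} {t : BisimType S P L}
    {l : List (S × Bool × M.W)} {w' v' : M'.W}
    (h : M'.PathType t (l.map fun x => (x.1, M.bisimType S P L x.2.2)) w' v') :
    ∃ l' : List (S × Bool × M'.W), IsPath w' l' ∧ endpoint w' l' = v' ∧
      List.Forall₂ (StepMatch P L) l l' ∧ M'.bisimType S P L w' = t := by
  induction l generalizing v' with
  | nil => exact ⟨[], trivial, h.1, .nil, h.2⟩
  | cons x l ih =>
    obtain ⟨u, h1, h2, h3⟩ := h
    obtain ⟨l', hl', rfl, hll, ht⟩ := ih h1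
    exact ⟨(x.1, true, v') :: l', ⟨hl', h2⟩, rfl, .cons ⟨rfl, h3.symm⟩ hll, ht⟩

end KModel

/-- Modal programs are safe for bisimulation. -/
theorem progSem_forth {A : Type} (π : MProg A) {M M' : KModel A} {Z : M.W → M'.W → Prop}
    (hZ : IsBisim M M' Z) {w v : M.W} {w' : M'.W} (hw : Z w w') (h : progSem M π w v) :
    ∃ v', Z v v' ∧ progSem M' π w' v' := by
  induction π generalizing M M' with
  | test p =>
    obtain ⟨rfl, h⟩ := h
    exact ⟨w', hw, rfl, (hZ.1 w w' hw p).1 h⟩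
  | atom a =>
    obtain ⟨v', h1, h2⟩ := hZ.2.1 a w w' v hw h
    exact ⟨v', h2, h1⟩
  | comp π ρ ihπ ihρ =>
    obtain ⟨u, h1, h2⟩ := h
    obtain ⟨u', hu, h1'⟩ := ihπ hZ hw h1
    obtain ⟨v', hv, h2'⟩ := ihρ hZ hu h2
    exact ⟨v', hv, u', h1', h2'⟩
  | union π ρ ihπ ihρ =>
    rcases h with h | h
    · obtain ⟨v', hv, h'⟩ := ihπ hZ hw h
      exact ⟨v', hv, Or.inl h'⟩
    · obtain ⟨v', hv, h'⟩ := ihρ hZ hw h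
      exact ⟨v', hv, Or.inr h'⟩
  | cneg π ih =>
    obtain ⟨rfl, h⟩ := h
    refine ⟨w', hw, rfl, fun ⟨u', hu'⟩ => h ?_⟩
    obtain ⟨u, -, hu⟩ := ih hZ.symm hw hu'
    exact ⟨u, hu⟩

/-- Bisimulation Safety Theorem in the finite: a first-order formula `φ(x,y)`
is safe for bisimulation over finite Kripke models iff there is a modal
program `π` such that `φ(x,y)` is equivalent, over finite Kripke models, to the
standard translation `ST_{x,y}(π)`, i.e. `φ` and `π` define the same binary
relation on every finite Kripke model. -/
theorem bisimulation_safety_finite {A : Type} (φ : (modalLang A).Formula (Fin 2)) :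
    SafeForBisimFin φ ↔
      ∃ π : MProg A, ∀ (M : KModel A), Finite M.W →
        ∀ w v : M.W, (FOSat M φ w v ↔ progSem M π w v) := by
  constructor
  · intro hφ
    obtain ⟨S, P, hSP⟩ := exists_sat_restrict_iff φ
    have hres : ∀ (M : KModel A) (w v : M.W),
        FOSat (M.restrict_s7 S P) φ w v ↔ FOSat M φ w v := fun M w v =>
      hSP S P (Finset.Subset.refl _) (Finset.Subset.refl _) M ![w, v] default
    let r := localityRadius (quantifierRank φ)
    let L := 3 * r + 1
    let G : Set (BisimType S P L × List (S × BisimType S P L)) :=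
      {σ | σ.2.length ≤ 2 * r + 1 ∧ ∀ M : KModel A, Finite M.W → M.Supported S P →
        ∀ w v : M.W, M.PathType σ.1 σ.2 w v → FOSat M φ w v}
    have hG : G.Finite :=
      (Set.finite_univ.prod (List.finite_length_le (S × BisimType S P L) (2 * r + 1))).subset
        fun σ hσ => ⟨Set.mem_univ _, hσ.1⟩
    obtain ⟨π, hπ⟩ := progDef_exists_mem hG fun σ => progDef_pathType σ.1 σ.2
    refine ⟨π, fun M hfin w v => (hres M w v).symm.trans (Iff.trans ?_ (hπ M w v).symm)⟩
    have : Finite (M.restrict_s7 S P).W := hfin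
    constructor
    · intro h
      obtain ⟨l, hlen, hl, hend, htrans⟩ := hφ.transfer (supported_restrict S P M) rfl le_rfl h
      refine ⟨⟨_, l.map fun x => (x.1, (M.restrict_s7 S P).bisimType S P L x.2.2)⟩,
        ⟨by simpa using hlen, fun M' hfin' hM' w' v' hp => ?_⟩,
        by simpa only [hend] using pathType_endpoint hl⟩
      obtain ⟨l', hl', rfl, hll, ht⟩ := hp.exists_path
      exact htrans M' w' l' hfin' hM' hl' hll ht.symm
    · rintro ⟨σ, hσ, hp⟩
      exact hσ.2 _ this (supported_restrict S P M) w v hp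
  · rintro ⟨π, hπ⟩ M M' hM hM' Z hZ
    constructor
    · intro w w' v hw h
      obtain ⟨v', hv, h'⟩ := progSem_forth π hZ hw ((hπ M hM w v).1 h)
      exact ⟨v', hv, (hπ M' hM' w' v').2 h'⟩
    · intro w w' v' hw h
      obtain ⟨v, hv, h'⟩ := progSem_forth π hZ.symm hw ((hπ M' hM' w' v').1 h)
      exact ⟨v, hv, (hπ M hM w v).2 h'⟩
end

section
/- For n ≥ 0, let 𝔉_n = (W,R) be the finite frame with W = {r} ∪ {a_i : 0 ≤ i ≤ n} ∪ {b_i : 0 ≤ i ≤ n} (all distinct), where R consists exactly of: (r, a_i) for all 0 ≤ i ≤ n; (a_i, b_j) iff j = i or j = i+1 (indices modulo n+1, so a_n also sees b_0); and (b_i, b_i) for all 0 ≤ i ≤ n. Then the McKinsey axiom □◇p → ◇□p is valid on 𝔉_n if and only if n is even. -/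
/-- A Kripke frame `(W, R)`. -/
structure Frame1 where
  W : Type
  R : W → W → Prop

/-- Basic modal formulas with propositional variables indexed by `ℕ`. -/
inductive BForm : Type
  | bot : BForm
  | var : ℕ → BForm
  | neg : BForm → BForm
  | and : BForm → BForm → BForm
  | or : BForm → BForm → BForm
  | imp : BForm → BForm → BForm
  | dia : BForm → BForm
  | box : BForm → BForm

/-- Kripke semantics. -/
def BSat (F : Frame1) (V : ℕ → Set F.W) : F.W → BForm → Prop
  | _, .bot => False
  | w, .var p => w ∈ V p
  | w, .neg φ => ¬ BSat F V w φ
  | w, .and φ ψ => BSat F V w φ ∧ BSat F V w ψ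
  | w, .or φ ψ => BSat F V w φ ∨ BSat F V w ψ
  | w, .imp φ ψ => BSat F V w φ → BSat F V w ψ
  | w, .dia φ => ∃ v, F.R w v ∧ BSat F V v φ
  | w, .box φ => ∀ v, F.R w v → BSat F V v φ

/-- `φ` is valid on the frame `F`: true at every world of every Kripke model
based on `F`. -/
def BValidOn (F : Frame1) (φ : BForm) : Prop :=
  ∀ (V : ℕ → Set F.W) (w : F.W), BSat F V w φ

/-- The McKinsey axiom `□◇p → ◇□p`. -/
def mckinsey : BForm := .imp (.box (.dia (.var 0))) (.dia (.box (.var 0)))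

/-- The frame `𝔉ₙ`: worlds are `r` (= `Sum.inl ()`), `a_i` (= `Sum.inr (Sum.inl i)`)
and `b_i` (= `Sum.inr (Sum.inr i)`) for `0 ≤ i ≤ n`; `r` sees every `a_i`;
`a_i` sees exactly `b_i` and `b_{i+1}` (indices mod `n+1`); and each `b_i` is
reflexive. -/
def FFrame (n : ℕ) : Frame1 where
  W := Unit ⊕ Fin (n + 1) ⊕ Fin (n + 1)
  R := fun x y =>
    match x, y with
    | Sum.inl _, Sum.inr (Sum.inl _) => True
    | Sum.inr (Sum.inl i), Sum.inr (Sum.inr j) => j = i ∨ j = i + 1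
    | Sum.inr (Sum.inr i), Sum.inr (Sum.inr j) => i = j
    | _, _ => False

/-- A set of vertices of the cycle `Fin (n + 1)` containing exactly one of any two consecutive
vertices exists iff the cycle has even length. -/
theorem exists_alternating_iff_odd (n : ℕ) :
    (∃ S : Set (Fin (n + 1)), ∀ i, i ∈ S ↔ i + 1 ∉ S) ↔ Odd n := by
  constructor
  · rintro ⟨S, hS⟩
    have key : ∀ k : ℕ, (Fin.ofNat (n + 1) k ∈ S ↔ ((0 : Fin (n + 1)) ∈ S ↔ Even k)) := by
      intro k
      induction k with
      | zero => simp
      | succ k ih =>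
        have h := hS (Fin.ofNat (n + 1) k)
        have hk : Fin.ofNat (n + 1) k + 1 = Fin.ofNat (n + 1) (k + 1) := by
          ext
          simp [Fin.val_add]
        rw [hk] at h
        rw [Nat.even_add_one]
        tauto
    have h := key (n + 1)
    rw [Fin.ofNat_self, Nat.even_add_one] at h
    rw [← Nat.not_even_iff_odd]
    tauto
  · intro hn
    refine ⟨{i | Even i.val}, fun i => ?_⟩
    rw [Set.mem_ofPred_eq, Set.mem_ofPred_eq, Fin.val_add_one]
    split_ifs with h
    · simpa [h] using hn
    · rw [Nat.even_add_one, not_not]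

/-- A refutation of the McKinsey axiom on `𝔉ₙ` amounts to a set of indices containing exactly one
of any two cyclically consecutive ones. -/
theorem mckinsey_valid_iff_not_exists_alternating (n : ℕ) :
    BValidOn (FFrame n) mckinsey ↔
      ¬ ∃ S : Set (Fin (n + 1)), ∀ i, i ∈ S ↔ i + 1 ∉ S := by
  constructor
  · rintro h ⟨S, hS⟩
    obtain ⟨v, hv, hbox⟩ := h (fun _ => {w | ∃ i ∈ S, w = Sum.inr (Sum.inr i)}) (Sum.inl ()) (by
      rintro (_ | i | i) hi
      · exact hi.elim
      · by_cases hiS : i ∈ S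
        · exact ⟨Sum.inr (Sum.inr i), Or.inl rfl, i, hiS, rfl⟩
        · exact ⟨Sum.inr (Sum.inr (i + 1)), Or.inr rfl, i + 1,
            by_contra fun hc => hiS ((hS i).2 hc), rfl⟩
      · exact hi.elim)
    rcases v with _ | i | i
    · exact hv
    · obtain ⟨j, hj, hij⟩ := hbox (Sum.inr (Sum.inr i)) (Or.inl rfl)
      obtain ⟨k, hk, hik⟩ := hbox (Sum.inr (Sum.inr (i + 1))) (Or.inr rfl)
      cases hij
      cases hik
      exact (hS i).1 hj hk
    · exact hv
  · intro h V w hw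
    rcases w with _ | i | i
    · by_contra hc
      refine h ⟨{i | Sum.inr (Sum.inr i) ∈ V 0}, fun i => ⟨fun hi hi' => hc ?_, fun hi => ?_⟩⟩
      · refine ⟨Sum.inr (Sum.inl i), trivial, ?_⟩
        rintro (_ | j | j) hj
        · exact hj.elim
        · exact hj.elim
        · rcases hj with rfl | rfl
          · exact hi
          · exact hi'
      · obtain ⟨v, hv, hvV⟩ := hw (Sum.inr (Sum.inl i)) trivial
        rcases v with _ | j | j
        · exact hv.elim
        · exact hv.elim
        · rcases hv with rfl | rfl
          · exact hvV
          · exact (hi hvV).elim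
    all_goals
      refine ⟨Sum.inr (Sum.inr i), by simp [FFrame], ?_⟩
      obtain ⟨v, hv, hvV⟩ := hw (Sum.inr (Sum.inr i)) (by simp [FFrame])
      rintro (_ | j | j) hj
      · exact hj.elim
      · exact hj.elim
      · rcases v with _ | k | k
        · exact hv.elim
        · exact hv.elim
        · cases hv
          cases hj
          exact hvV

/-- Lemma 5.8: the McKinsey axiom is valid on `𝔉ₙ` iff `n` is even. -/
theorem mckinsey_valid_iff_even (n : ℕ) :
    BValidOn (FFrame n) mckinsey ↔ Even n := by
  rw [mckinsey_valid_iff_not_exists_alternating, exists_alternating_iff_odd, Nat.not_odd_iff_even]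
end

section
/- For n ≥ 0, let 𝔊_n = (W,R',P) be the finite structure over the signature with one binary relation R' and one unary relation P, with domain W = {r} ∪ {a_i : 0 ≤ i ≤ n} ∪ {b_i : 0 ≤ i ≤ n} (all distinct), where R' consists exactly of (a_i, b_j) iff j = i or j = i+1 (indices modulo n+1) and (b_i, b_i) for all 0 ≤ i ≤ n, and where P = {r}. Then for every first-order sentence φ over this signature there exists an even natural number n such that 𝔊_n ⊨ φ if and only if 𝔊_{n+1} ⊨ φ. -/
/-- A first-order structure over the signature with one binary relation symbol
`R'` and one unary relation symbol `P`. -/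
structure PStruct where
  W : Type
  R : W → W → Prop
  P : Set W

/-- First-order formulas over the signature `{R' (binary), P (unary)}`, with
variables indexed by `ℕ`. -/
inductive FO2 : Type
  | eq : ℕ → ℕ → FO2
  | rel : ℕ → ℕ → FO2
  | pr : ℕ → FO2
  | fal : FO2
  | neg : FO2 → FO2
  | and : FO2 → FO2 → FO2
  | or : FO2 → FO2 → FO2
  | imp : FO2 → FO2 → FO2
  | ex : ℕ → FO2 → FO2
  | all : ℕ → FO2 → FO2

/-- Tarskian satisfaction relative to an assignment `g`. -/
def FO2Sat (S : PStruct) : (ℕ → S.W) → FO2 → Prop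
  | g, .eq x y => g x = g y
  | g, .rel x y => S.R (g x) (g y)
  | g, .pr x => g x ∈ S.P
  | _, .fal => False
  | g, .neg φ => ¬ FO2Sat S g φ
  | g, .and φ ψ => FO2Sat S g φ ∧ FO2Sat S g ψ
  | g, .or φ ψ => FO2Sat S g φ ∨ FO2Sat S g ψ
  | g, .imp φ ψ => FO2Sat S g φ → FO2Sat S g ψ
  | g, .ex x φ => ∃ d : S.W, FO2Sat S (Function.update g x d) φ
  | g, .all x φ => ∀ d : S.W, FO2Sat S (Function.update g x d) φ

/-- Free variables. -/
def FO2.freeVars : FO2 → Finset ℕ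
  | .eq x y => {x, y}
  | .rel x y => {x, y}
  | .pr x => {x}
  | .fal => ∅
  | .neg φ => φ.freeVars
  | .and φ ψ => φ.freeVars ∪ ψ.freeVars
  | .or φ ψ => φ.freeVars ∪ ψ.freeVars
  | .imp φ ψ => φ.freeVars ∪ ψ.freeVars
  | .ex x φ => φ.freeVars \ {x}
  | .all x φ => φ.freeVars \ {x}

/-- Truth of a (closed) formula in a structure. -/
def PSat (S : PStruct) (φ : FO2) : Prop :=
  ∀ g : ℕ → S.W, FO2Sat S g φ

/-- The structure `𝔊ₙ`: domain `{r} ∪ {a_i} ∪ {b_i}` (`r = Sum.inl ()`,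
`a_i = Sum.inr (Sum.inl i)`, `b_i = Sum.inr (Sum.inr i)`, `0 ≤ i ≤ n`);
`R'` consists exactly of `(a_i, b_j)` iff `j = i` or `j = i+1` (mod `n+1`)
and the loops `(b_i, b_i)`; and `P = {r}`. -/
def GStruct (n : ℕ) : PStruct where
  W := Unit ⊕ Fin (n + 1) ⊕ Fin (n + 1)
  R := fun x y =>
    match x, y with
    | Sum.inr (Sum.inl i), Sum.inr (Sum.inr j) => j = i ∨ j = i + 1
    | Sum.inr (Sum.inr i), Sum.inr (Sum.inr j) => i = j
    | _, _ => False
  P := {Sum.inl ()}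

namespace GStruct

/-- The sort of an element: `none` for the root, `some false` for the `a_i`, `some true` for
the `b_i`. -/
def kind {n : ℕ} : (GStruct n).W → Option Bool
  | Sum.inl _ => none
  | Sum.inr (Sum.inl _) => some false
  | Sum.inr (Sum.inr _) => some true

/-- The index of an element on the cycle (with the value `0` at the root). -/
def pos {n : ℕ} : (GStruct n).W → ZMod (n + 1)
  | Sum.inl _ => 0
  | Sum.inr (Sum.inl i) => i
  | Sum.inr (Sum.inr i) => i

theorem exists_kind_pos {n : ℕ} (k : Option Bool) (i : ZMod (n + 1)) :
    ∃ w : (GStruct n).W, kind w = k ∧ (k ≠ none → pos w = i) := by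
  rcases k with _ | _ | _
  · exact ⟨Sum.inl (), rfl, fun h => absurd rfl h⟩
  · exact ⟨Sum.inr (Sum.inl i), rfl, fun _ => rfl⟩
  · exact ⟨Sum.inr (Sum.inr i), rfl, fun _ => rfl⟩

theorem eq_iff {n : ℕ} (u v : (GStruct n).W) :
    u = v ↔ kind u = kind v ∧ (kind u ≠ none → pos v = pos u) := by
  refine ⟨by rintro rfl; simp, fun ⟨hk, hp⟩ => ?_⟩
  rcases u with ⟨⟩ | i | i <;> rcases v with ⟨⟩ | j | j <;> simp [kind, pos] at hk hp
  · rfl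
  · rw [hp]
  · rw [hp]

theorem rel_iff {n : ℕ} (u v : (GStruct n).W) :
    (GStruct n).R u v ↔ kind u ≠ none ∧ kind v = some true ∧
      (pos v = pos u ∨ kind u = some false ∧ pos v = pos u + 1) := by
  rcases u with ⟨⟩ | i | i <;> rcases v with ⟨⟩ | j | j <;> simp [kind, pos, GStruct]
  · rfl
  · exact eq_comm

theorem mem_P_iff {n : ℕ} (u : (GStruct n).W) : u ∈ (GStruct n).P ↔ kind u = none := by
  rcases u with ⟨⟩ | i | i
  · exact iff_of_true rfl rfl
  · exact iff_of_false nofun nofun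
  · exact iff_of_false nofun nofun

/-- The assignments `g` and `h` agree on the variables in `s` up to cyclic distance `r`. -/
def Similar {n m : ℕ} (r : ℕ) (s : Finset ℕ) (g : ℕ → (GStruct n).W) (h : ℕ → (GStruct m).W) :
    Prop :=
  (∀ x ∈ s, kind (g x) = kind (h x)) ∧
    ∀ x ∈ s, ∀ y ∈ s, kind (g x) ≠ none → kind (g y) ≠ none → ∀ t : ℤ, |t| ≤ r →
      (pos (g y) = pos (g x) + t ↔ pos (h y) = pos (h x) + t)

namespace Similar

variable {n m r r' : ℕ} {s s' : Finset ℕ} {g : ℕ → (GStruct n).W} {h : ℕ → (GStruct m).W}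

theorem mono (H : Similar r s g h) (hr : r' ≤ r) (hs : s' ⊆ s) : Similar r' s' g h :=
  ⟨fun x hx => H.1 x (hs hx), fun x hx y hy hgx hgy t ht =>
    H.2 x (hs hx) y (hs hy) hgx hgy t (ht.trans (by exact_mod_cast hr))⟩

theorem symm (H : Similar r s g h) : Similar r s h g :=
  ⟨fun x hx => (H.1 x hx).symm, fun x hx y hy hhx hhy t ht =>
    (H.2 x hx y hy (by rwa [H.1 x hx]) (by rwa [H.1 y hy]) t ht).symm⟩

end Similar

/-- A point on one cycle can be matched on another sufficiently large cycle, respecting all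
distances up to `r` to points that already match up to distance `2 * r`. -/
theorem exists_matching_point {N M : ℕ} [NeZero M] (r : ℕ) (s : Finset ℕ) (p : ℕ → ZMod N)
    (q : ℕ → ZMod M)
    (H : ∀ x ∈ s, ∀ y ∈ s, ∀ t : ℤ, |t| ≤ (2 * r : ℕ) → (p y = p x + t ↔ q y = q x + t))
    (hM : s.card * (2 * r + 1) < M) (i : ZMod N) :
    ∃ j : ZMod M, ∀ x ∈ s, ∀ t : ℤ, |t| ≤ r → (p x = i + t ↔ q x = j + t) := by
  by_cases hnear : ∃ x ∈ s, ∃ t : ℤ, |t| ≤ r ∧ i = p x + t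
  · obtain ⟨x, hx, t, ht, rfl⟩ := hnear
    refine ⟨q x + t, fun y hy u hu => ?_⟩
    have := H x hx y hy (t + u) ((abs_add_le t u).trans (by push_cast; lia))
    push_cast at this
    rwa [add_assoc, add_assoc]
  · push Not at hnear
    let bad : Finset (ZMod M) :=
      (s ×ˢ Finset.Icc (-r : ℤ) r).image fun z => q z.1 + (z.2 : ZMod M)
    have hbad : bad.card < Fintype.card (ZMod M) := by
      refine lt_of_le_of_lt Finset.card_image_le ?_
      rw [Finset.card_product, Int.card_Icc, ZMod.card]
      have : ((r : ℤ) + 1 - -r).toNat = 2 * r + 1 := by lia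
      rwa [this]
    obtain ⟨j, hj⟩ : ∃ j, j ∉ bad := by
      by_contra! hall
      exact hbad.ne (by rw [Finset.eq_univ_of_forall hall, Finset.card_univ])
    refine ⟨j, fun x hx t ht => iff_of_false (fun hp => ?_) fun hq => hj ?_⟩
    · exact hnear x hx (-t) (by rwa [abs_neg]) (by rw [hp]; push_cast; ring)
    · refine Finset.mem_image.2 ⟨(x, -t), ?_, by simp [hq]⟩
      rw [abs_le] at ht
      simp only [Finset.mem_product, Finset.mem_Icc]
      exact ⟨hx, by lia, by lia⟩

theorem self_eq_add_intCast_iff {N : ℕ} {t : ℤ} (ht : |t| < N) (i : ZMod N) :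
    i = i + t ↔ t = 0 := by
  rw [left_eq_add, ZMod.intCast_zmod_eq_zero_iff_dvd]
  exact ⟨fun hd => Int.eq_zero_of_abs_lt_dvd hd ht, fun h => h ▸ dvd_zero _⟩

/-- The forth property of `Similar`. -/
theorem Similar.exists_update {n m r : ℕ} {s : Finset ℕ} {g : ℕ → (GStruct n).W}
    {h : ℕ → (GStruct m).W} {x : ℕ} (H : Similar (2 * r) (s \ {x}) g h)
    (hn : (s.card + 1) * (2 * r + 1) ≤ n) (hm : (s.card + 1) * (2 * r + 1) ≤ m)
    (d : (GStruct n).W) :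
    ∃ e : (GStruct m).W, Similar r s (Function.update g x d) (Function.update h x e) := by
  obtain ⟨hkind, hpos⟩ := H
  obtain ⟨j, hj⟩ := exists_matching_point r {y ∈ s \ {x} | kind (g y) ≠ none}
    (fun y => pos (g y)) (fun y => pos (h y))
    (fun y hy z hz t ht => by
      rw [Finset.mem_filter] at hy hz
      exact hpos y hy.1 z hz.1 hy.2 hz.2 t ht)
    (M := m + 1)
    (by
      have : Finset.card {y ∈ s \ {x} | kind (g y) ≠ none} ≤ s.card :=
        Finset.card_le_card ((Finset.filter_subset _ _).trans Finset.sdiff_subset)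
      nlinarith)
    (pos d)
  obtain ⟨e, hek, hep⟩ := exists_kind_pos (kind d) j
  refine ⟨e, fun y hy => ?_, fun y hy z hz hgy hgz t ht => ?_⟩
  · by_cases hyx : y = x
    · subst hyx; simp [hek]
    · simpa [hyx] using hkind y (by simp [hy, hyx])
  · by_cases hyx : y = x <;> by_cases hzx : z = x
    · subst hyx hzx
      simp only [Function.update_self]
      rw [self_eq_add_intCast_iff, self_eq_add_intCast_iff] <;> push_cast <;> nlinarith
    · subst hyx
      simp only [Function.update_self, Function.update_of_ne hzx] at hgy hgz ⊢
      rw [hep hgy]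
      exact hj z (by simp [hz, hzx, hgz]) t ht
    · subst hzx
      simp only [Function.update_self, Function.update_of_ne hyx] at hgy hgz ⊢
      rw [hep hgz]
      have := hj y (by simp [hy, hyx, hgy]) (-t) (by rwa [abs_neg])
      push_cast at this
      rw [← sub_eq_add_neg, ← sub_eq_add_neg, eq_sub_iff_add_eq, eq_sub_iff_add_eq] at this
      rw [eq_comm, this, eq_comm]
    · simp only [Function.update_of_ne hyx, Function.update_of_ne hzx] at hgy hgz ⊢
      exact hpos y (by simp [hy, hyx]) z (by simp [hz, hzx]) hgy hgz t
        (ht.trans (by push_cast; lia))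

/-- `φ` does not distinguish `r`-similar assignments in structures of index at least `k`. -/
def Indistinguishable (r k : ℕ) (φ : FO2) : Prop :=
  ∀ n m : ℕ, k ≤ n → k ≤ m → ∀ (g : ℕ → (GStruct n).W) (h : ℕ → (GStruct m).W),
    Similar r φ.freeVars g h → (FO2Sat _ g φ ↔ FO2Sat _ h φ)

theorem Indistinguishable.pair {r k r' k' : ℕ} {φ ψ χ : FO2} (hφ : Indistinguishable r k φ)
    (hψ : Indistinguishable r' k' ψ) (hχ : χ.freeVars = φ.freeVars ∪ ψ.freeVars)
    (hsat : ∀ n m : ℕ, ∀ (g : ℕ → (GStruct n).W) (h : ℕ → (GStruct m).W),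
      (FO2Sat _ g φ ↔ FO2Sat _ h φ) → (FO2Sat _ g ψ ↔ FO2Sat _ h ψ) →
        (FO2Sat _ g χ ↔ FO2Sat _ h χ)) :
    Indistinguishable (max r r') (max k k') χ := by
  intro n m hn hm g h H
  rw [hχ] at H
  rw [max_le_iff] at hn hm
  exact hsat n m g h
    (hφ n m hn.1 hm.1 g h (H.mono (le_max_left _ _) Finset.subset_union_left))
    (hψ n m hn.2 hm.2 g h (H.mono (le_max_right _ _) Finset.subset_union_right))

/-- If `φ` is indistinguishable at radius `r`, each new value for the variable `x` on one side
is matched on the other side, as far as `φ` can tell. -/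
theorem Indistinguishable.exists_update {r k : ℕ} {φ : FO2} (hφ : Indistinguishable r k φ)
    {n m x : ℕ} (hn : max k ((φ.freeVars.card + 1) * (2 * r + 1)) ≤ n)
    (hm : max k ((φ.freeVars.card + 1) * (2 * r + 1)) ≤ m)
    {g : ℕ → (GStruct n).W} {h : ℕ → (GStruct m).W}
    (H : Similar (2 * r) (φ.freeVars \ {x}) g h) (d : (GStruct n).W) :
    ∃ e : (GStruct m).W,
      FO2Sat _ (Function.update g x d) φ ↔ FO2Sat _ (Function.update h x e) φ := by
  rw [max_le_iff] at hn hm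
  obtain ⟨e, he⟩ := H.exists_update hn.2 hm.2 d
  exact ⟨e, hφ n m hn.1 hm.1 _ _ he⟩

theorem exists_indistinguishable (φ : FO2) : ∃ r k : ℕ, Indistinguishable r k φ := by
  induction φ with
  | eq x y =>
    refine ⟨0, 0, fun n m _ _ g h H => ?_⟩
    have hx := H.1 x (by simp [FO2.freeVars])
    have hy := H.1 y (by simp [FO2.freeVars])
    have hxy := H.2 x (by simp [FO2.freeVars]) y (by simp [FO2.freeVars])
    simp only [FO2Sat, eq_iff, ← hx, ← hy]
    refine and_congr_right fun hk => forall_congr' fun hgx => ?_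
    simpa using hxy hgx (hk ▸ hgx) 0 (by simp)
  | rel x y =>
    refine ⟨1, 0, fun n m _ _ g h H => ?_⟩
    have hx := H.1 x (by simp [FO2.freeVars])
    have hy := H.1 y (by simp [FO2.freeVars])
    have hxy := H.2 x (by simp [FO2.freeVars]) y (by simp [FO2.freeVars])
    simp only [FO2Sat, rel_iff, ← hx, ← hy]
    refine and_congr_right fun hgx => and_congr_right fun hgy => ?_
    have h0 := hxy hgx (by simp [hgy]) 0 (by simp)
    have h1 := hxy hgx (by simp [hgy]) 1 (by simp)
    simp only [Int.cast_zero, add_zero, Int.cast_one] at h0 h1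
    rw [h0, h1]
  | pr x =>
    refine ⟨0, 0, fun n m _ _ g h H => ?_⟩
    simp only [FO2Sat, mem_P_iff, H.1 x (by simp [FO2.freeVars])]
  | fal => exact ⟨0, 0, fun n m _ _ g h _ => Iff.rfl⟩
  | neg φ ih =>
    obtain ⟨r, k, hφ⟩ := ih
    exact ⟨r, k, fun n m hn hm g h H => not_congr (hφ n m hn hm g h H)⟩
  | and φ ψ ihφ ihψ =>
    obtain ⟨r, k, hφ⟩ := ihφ
    obtain ⟨r', k', hψ⟩ := ihψ
    exact ⟨_, _, hφ.pair hψ rfl fun _ _ _ _ => and_congr⟩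
  | or φ ψ ihφ ihψ =>
    obtain ⟨r, k, hφ⟩ := ihφ
    obtain ⟨r', k', hψ⟩ := ihψ
    exact ⟨_, _, hφ.pair hψ rfl fun _ _ _ _ => or_congr⟩
  | imp φ ψ ihφ ihψ =>
    obtain ⟨r, k, hφ⟩ := ihφ
    obtain ⟨r', k', hψ⟩ := ihψ
    exact ⟨_, _, hφ.pair hψ rfl fun _ _ _ _ => imp_congr⟩
  | ex x φ ih =>
    obtain ⟨r, k, hφ⟩ := ih
    refine ⟨2 * r, max k ((φ.freeVars.card + 1) * (2 * r + 1)), fun n m hn hm g h H => ?_⟩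
    constructor
    · rintro ⟨d, hd⟩
      obtain ⟨e, he⟩ := hφ.exists_update hn hm H d
      exact ⟨e, he.1 hd⟩
    · rintro ⟨d, hd⟩
      obtain ⟨e, he⟩ := hφ.exists_update hm hn H.symm d
      exact ⟨e, he.1 hd⟩
  | all x φ ih =>
    obtain ⟨r, k, hφ⟩ := ih
    refine ⟨2 * r, max k ((φ.freeVars.card + 1) * (2 * r + 1)), fun n m hn hm g h H => ?_⟩
    constructor
    · intro hall d
      obtain ⟨e, he⟩ := hφ.exists_update hm hn H.symm d
      exact he.2 (hall e)
    · intro hall d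
      obtain ⟨e, he⟩ := hφ.exists_update hn hm H d
      exact he.2 (hall e)

end GStruct

/-- Lemma 5.10: for every first-order sentence `φ` over `{R', P}` there is an
even `n` such that `𝔊ₙ ⊨ φ` iff `𝔊ₙ₊₁ ⊨ φ`. -/
theorem exists_even_G_agree (φ : FO2) (hsent : φ.freeVars = ∅) :
    ∃ n : ℕ, Even n ∧ (PSat (GStruct n) φ ↔ PSat (GStruct (n + 1)) φ) := by
  obtain ⟨r, k, hφ⟩ := GStruct.exists_indistinguishable φ
  have key : ∀ (g : ℕ → (GStruct (2 * k)).W) (h : ℕ → (GStruct (2 * k + 1)).W),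
      FO2Sat _ g φ ↔ FO2Sat _ h φ := fun g h =>
    hφ _ _ (by lia) (by lia) g h (by simp [hsent, GStruct.Similar])
  exact ⟨2 * k, even_two_mul k, fun H h => (key (fun _ => Sum.inl ()) h).1 (H _),
    fun H g => (key g fun _ => Sum.inl ()).2 (H _)⟩
end
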